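/- Let m > 0 and let V : ℝ → ℝ be a polynomial with V(0) = V'(0) = V''(0) = 0 and V(s) ≥ 0 for all s ∈ ℝ. Let Φ be a global solution of the nonlinear Klein–Gordon equation ∂ₜ²Φ − ΔΦ + m²Φ + V'(Φ) = 0 with Schwartz Cauchy data, and let Φ⁺ be a free solution which is its future free asymptote. Then for all t, s ∈ ℝ: ∫_{ℝ³} ( ½ (∂ₜΦ(t,x))² + ½ ‖∇ₓΦ(t,x)‖² + ½ m² Φ(t,x)² + V(Φ(t,x)) ) dx = ∫_{ℝ³} ( ½ (∂ₜΦ⁺(s,x))² + ½ ‖∇ₓΦ⁺(s,x)‖² + ½ m² Φ⁺(s,x)² ) dx; i.e., the (conserved) interacting energy of Φ equals the free energy of its asymptote. The same holds for a past free asymptote Φ⁻. -/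

import Mathlib

noncomputable section

open MeasureTheory Filter Polynomial

open scoped Topology ENNReal

abbrev E3 := EuclideanSpace ℝ (Fin 3)

/-- Time derivative `∂ₜΦ(t, x)`. -/
def timeDeriv (Φ : ℝ × E3 → ℝ) (t : ℝ) (x : E3) : ℝ := deriv (fun s => Φ (s, x)) t

/-- The spatial Laplacian `Δf(x) = ∑ⱼ ∂ⱼ²f(x)`. -/
def lapl (f : E3 → ℝ) (x : E3) : ℝ :=
  ∑ i : Fin 3, iteratedDeriv 2 (fun s : ℝ => f (x + s • EuclideanSpace.single i (1 : ℝ))) 0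

/-- A global solution of the nonlinear Klein-Gordon equation
`∂ₜ²Φ − ΔΦ + m²Φ + V'(Φ) = 0`: a smooth real function on `ℝ × ℝ³` satisfying the
equation, such that `Φ(t,·)` and `∂ₜΦ(t,·)` are Schwartz for every `t`. -/
def IsGlobalSol (m : ℝ) (V : Polynomial ℝ) (Φ : ℝ × E3 → ℝ) : Prop :=
  ContDiff ℝ (⊤ : ℕ∞) Φ ∧
  (∀ (t : ℝ) (x : E3),
    iteratedDeriv 2 (fun s => Φ (s, x)) t - lapl (fun y => Φ (t, y)) x
      + m ^ 2 * Φ (t, x) + (Polynomial.derivative V).eval (Φ (t, x)) = 0) ∧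
  (∀ t : ℝ, ∃ g : SchwartzMap E3 ℝ, ∀ x, g x = Φ (t, x)) ∧
  (∀ t : ℝ, ∃ g : SchwartzMap E3 ℝ, ∀ x, g x = timeDeriv Φ t x)

/-- A free solution: a global solution of the linear Klein-Gordon equation (`V' = 0`). -/
def IsFreeSol (m : ℝ) (Φ : ℝ × E3 → ℝ) : Prop := IsGlobalSol m 0 Φ

/-- `Φ` has Cauchy data `(φ, π)` at `t = 0`. -/
def InitData (Φ : ℝ × E3 → ℝ) (φ π : SchwartzMap E3 ℝ) : Prop :=
  (∀ x, Φ (0, x) = φ x) ∧ (∀ x, timeDeriv Φ 0 x = π x)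

/-- `Ψ` is a future asymptote of `Φ`: the `L² ⊕ L²` distance of the Cauchy data at time
`t` tends to `0` as `t → +∞`. -/
def FutureAsym (Φ Ψ : ℝ × E3 → ℝ) : Prop :=
  Tendsto (fun t : ℝ =>
      eLpNorm (fun x => Φ (t, x) - Ψ (t, x)) 2 volume
        + eLpNorm (fun x => timeDeriv Φ t x - timeDeriv Ψ t x) 2 volume)
    atTop (𝓝 (0 : ℝ≥0∞))

/-- `Ψ` is a past asymptote of `Φ`: same as `FutureAsym` but as `t → −∞`. -/
def PastAsym (Φ Ψ : ℝ × E3 → ℝ) : Prop :=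
  Tendsto (fun t : ℝ =>
      eLpNorm (fun x => Φ (t, x) - Ψ (t, x)) 2 volume
        + eLpNorm (fun x => timeDeriv Φ t x - timeDeriv Ψ t x) 2 volume)
    atBot (𝓝 (0 : ℝ≥0∞))

/-- The directional derivative of `f` along `v`. -/
def pd (v : ℝ × E3) (f : ℝ × E3 → ℝ) : ℝ × E3 → ℝ := fun p => fderiv ℝ f p v

/-- The unit vector in the time direction. -/
def e0 : ℝ × E3 := (1, 0)

/-- The unit vectors in the space directions. -/
def ej (j : Fin 3) : ℝ × E3 := (0, EuclideanSpace.single j 1)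

/-- Smooth functions on space-time. -/
abbrev Smooth (f : ℝ × E3 → ℝ) : Prop := ContDiff ℝ (⊤ : ℕ∞) f

section Calculus

variable {f g : ℝ × E3 → ℝ} {v w : ℝ × E3}

lemma Smooth.diff (hf : Smooth f) : Differentiable ℝ f := hf.differentiable (by simp)

lemma Smooth.dir (hf : Smooth f) : Smooth (pd v f) :=
  (hf.fderiv_right (m := (⊤ : ℕ∞)) (by simp)).clm_apply contDiff_const

lemma pd_comm (hf : Smooth f) : pd v (pd w f) = pd w (pd v f) := by
  funext p
  have h2 : Differentiable ℝ (fderiv ℝ f) :=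
    (hf.fderiv_right (m := (⊤ : ℕ∞)) (by simp)).differentiable (by simp)
  have key : ∀ a b : ℝ × E3, pd a (pd b f) p = fderiv ℝ (fderiv ℝ f) p a b := by
    intro a b
    change fderiv ℝ (fun y => fderiv ℝ f y b) p a = _
    rw [fderiv_clm_apply (h2 p) (differentiableAt_const _)]
    simp
  rw [key, key]
  exact (hf.contDiffAt.isSymmSndFDerivAt (by
    simpa using! (WithTop.coe_le_coe.2 le_top : ((2 : ℕ∞) : WithTop ℕ∞) ≤ ((⊤ : ℕ∞) : WithTop ℕ∞)))).eq v w

lemma pd_add (hf : Smooth f) (hg : Smooth g) (p : ℝ × E3) :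
    pd v (fun q => f q + g q) p = pd v f p + pd v g p := by
  simp only [pd]
  rw [fderiv_fun_add (hf.diff p) (hg.diff p)]; rfl

lemma pd_sub (hf : Smooth f) (hg : Smooth g) (p : ℝ × E3) :
    pd v (fun q => f q - g q) p = pd v f p - pd v g p := by
  simp only [pd]
  rw [fderiv_fun_sub (hf.diff p) (hg.diff p)]; rfl

lemma pd_mul (hf : Smooth f) (hg : Smooth g) (p : ℝ × E3) :
    pd v (fun q => f q * g q) p = pd v f p * g p + f p * pd v g p := by
  simp only [pd]
  rw [fderiv_fun_mul (hf.diff p) (hg.diff p)]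
  simp; ring

lemma pd_const_mul (c : ℝ) (hf : Smooth f) (p : ℝ × E3) :
    pd v (fun q => c * f q) p = c * pd v f p := by
  simp only [pd]
  rw [fderiv_const_mul (hf.diff p)]; simp

lemma pd_sq (hf : Smooth f) (p : ℝ × E3) :
    pd v (fun q => f q ^ 2) p = 2 * f p * pd v f p := by
  simp only [pow_two]
  rw [pd_mul hf hf]; ring

lemma pd_eval (V : Polynomial ℝ) (hf : Smooth f) (p : ℝ × E3) :
    pd v (fun q => V.eval (f q)) p = (derivative V).eval (f p) * pd v f p := by
  simp only [pd]
  have := (V.hasDerivAt (f p)).comp_hasFDerivAt p (hf.diff p).hasFDerivAt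
  rw [HasFDerivAt.fderiv (f := fun q => V.eval (f q)) this]
  simp

lemma Smooth.eval (V : Polynomial ℝ) (hf : Smooth f) : Smooth (fun q => V.eval (f q)) :=
  by
  simpa [Function.comp_def] using (Polynomial.contDiff_aeval V _).comp hf

lemma pd_sum {ι : Type*} (s : Finset ι) {f : ι → ℝ × E3 → ℝ} (hf : ∀ i, Smooth (f i))
    (p : ℝ × E3) :
    pd v (fun q => ∑ i ∈ s, f i q) p = ∑ i ∈ s, pd v (f i) p := by
  simp only [pd]
  rw [fderiv_fun_sum (fun i _ => (hf i).diff p)]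
  simp

lemma timeDeriv_eq_pd (hf : Smooth f) (t : ℝ) (x : E3) : timeDeriv f t x = pd e0 f (t, x) := by
  have h : HasDerivAt (fun s : ℝ => ((s, x) : ℝ × E3)) (1, 0) t :=
    (hasDerivAt_id t).prodMk (hasDerivAt_const t x)
  exact ((hf.diff (t, x)).hasFDerivAt.comp_hasDerivAt t h).deriv

lemma iteratedDeriv_time_eq_pd (hf : Smooth f) (t : ℝ) (x : E3) :
    iteratedDeriv 2 (fun s => f (s, x)) t = pd e0 (pd e0 f) (t, x) := by
  have h1 : deriv (fun s => f (s, x)) = fun s => pd e0 f (s, x) :=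
    funext fun s => timeDeriv_eq_pd hf s x
  rw [iteratedDeriv_succ, iteratedDeriv_one, h1]
  exact timeDeriv_eq_pd hf.dir t x

lemma hasDerivAt_space_line (hf : Smooth f) (t : ℝ) (x v : E3) (s : ℝ) :
    HasDerivAt (fun s : ℝ => f (t, x + s • v)) (pd (0, v) f (t, x + s • v)) s := by
  have h : HasDerivAt (fun s : ℝ => ((t, x + s • v) : ℝ × E3)) (0, v) s := by
    refine (hasDerivAt_const s t).prodMk ?_
    simpa using ((hasDerivAt_id s).smul_const v).const_add x
  exact (hf.diff _).hasFDerivAt.comp_hasDerivAt s h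

lemma lapl_eq_pd (hf : Smooth f) (t : ℝ) (x : E3) :
    lapl (fun y => f (t, y)) x = ∑ j, pd (ej j) (pd (ej j) f) (t, x) := by
  refine Finset.sum_congr rfl fun j _ => ?_
  have h1 : deriv (fun s : ℝ => f (t, x + s • EuclideanSpace.single j (1 : ℝ))) =
      fun s => pd (ej j) f (t, x + s • EuclideanSpace.single j (1 : ℝ)) :=
    funext fun s => (hasDerivAt_space_line hf t x _ s).deriv
  rw [iteratedDeriv_succ, iteratedDeriv_one, h1]
  simpa using! (hasDerivAt_space_line (hf.dir (v := ej j)) t x (EuclideanSpace.single j 1) 0).deriv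

lemma fderiv_slice (hf : Smooth f) (t : ℝ) (x v : E3) :
    fderiv ℝ (fun y => f (t, y)) x v = pd (0, v) f (t, x) := by
  have h : HasFDerivAt (fun y : E3 => ((t, y) : ℝ × E3))
      ((0 : E3 →L[ℝ] ℝ).prod (ContinuousLinearMap.id ℝ E3)) x :=
    (hasFDerivAt_const t x).prodMk (hasFDerivAt_id x)
  have := ((hf.diff (t, x)).hasFDerivAt.comp x h).fderiv
  simp only [Function.comp_def] at this
  rw [this]; rfl

lemma norm_gradient_sq (hf : Smooth f) (t : ℝ) (x : E3) :
    ‖gradient (fun y => f (t, y)) x‖ ^ 2 = ∑ j, pd (ej j) f (t, x) ^ 2 := by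
  rw [EuclideanSpace.norm_sq_eq]
  refine Finset.sum_congr rfl fun j _ => ?_
  rw [← show fderiv ℝ (fun y => f (t, y)) x (EuclideanSpace.single j 1) = pd (ej j) f (t, x) from
    fderiv_slice hf t x _]
  have := InnerProductSpace.toDual_symm_apply (𝕜 := ℝ) (x := EuclideanSpace.single j (1 : ℝ))
    (y := fderiv ℝ (fun y => f (t, y)) x)
  rw [← this, ← gradient, EuclideanSpace.inner_single_right]
  simp

end Calculus

/-- The energy density. -/
def en (m : ℝ) (V : Polynomial ℝ) (Φ : ℝ × E3 → ℝ) (p : ℝ × E3) : ℝ :=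
  (1 / 2) * pd e0 Φ p ^ 2 + (1 / 2) * ∑ j, pd (ej j) Φ p ^ 2 + (1 / 2) * m ^ 2 * Φ p ^ 2
    + V.eval (Φ p)

/-- Smooth solutions, without decay assumptions. -/
def SmoothSol (m : ℝ) (V : Polynomial ℝ) (Φ : ℝ × E3 → ℝ) : Prop :=
  Smooth Φ ∧ ∀ p, pd e0 (pd e0 Φ) p - ∑ j, pd (ej j) (pd (ej j) Φ) p + m ^ 2 * Φ p
      + (derivative V).eval (Φ p) = 0

/-- Both Cauchy data are Schwartz functions at every time. -/
def SchwartzData (Φ : ℝ × E3 → ℝ) : Prop :=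
  ∀ t : ℝ, (∃ g : SchwartzMap E3 ℝ, ∀ x, g x = Φ (t, x)) ∧
    ∃ g : SchwartzMap E3 ℝ, ∀ x, g x = pd e0 Φ (t, x)

lemma IsGlobalSol.smoothSol {m : ℝ} {V : Polynomial ℝ} {Φ : ℝ × E3 → ℝ}
    (h : IsGlobalSol m V Φ) : SmoothSol m V Φ := by
  obtain ⟨hs, he, -, -⟩ := h
  refine ⟨hs, fun p => ?_⟩
  have := he p.1 p.2
  rwa [iteratedDeriv_time_eq_pd hs, lapl_eq_pd hs] at this

lemma IsGlobalSol.schwartzData {m : ℝ} {V : Polynomial ℝ} {Φ : ℝ × E3 → ℝ}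
    (h : IsGlobalSol m V Φ) : SchwartzData Φ := by
  obtain ⟨hs, -, h1, h2⟩ := h
  refine fun t => ⟨h1 t, ?_⟩
  obtain ⟨g, hg⟩ := h2 t
  exact ⟨g, fun x => by rw [hg, timeDeriv_eq_pd hs]⟩

lemma en_nonneg {m : ℝ} {V : Polynomial ℝ} (hV : ∀ s, 0 ≤ V.eval s) (Φ : ℝ × E3 → ℝ)
    (p : ℝ × E3) : 0 ≤ en m V Φ p := by
  have := hV (Φ p)
  have : 0 ≤ ∑ j, pd (ej j) Φ p ^ 2 := Finset.sum_nonneg fun j _ => sq_nonneg _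
  unfold en
  positivity

lemma Smooth.energy {m : ℝ} {V : Polynomial ℝ} {Φ : ℝ × E3 → ℝ} (h : Smooth Φ) :
    Smooth (en m V Φ) := by
  have h0 := h.dir (v := e0)
  have hj : ∀ j, Smooth (pd (ej j) Φ) := fun j => h.dir
  have := h.eval V
  exact (((contDiff_const.mul (h0.pow 2)).add
    (contDiff_const.mul (ContDiff.sum fun j _ => (hj j).pow 2))).add
      (contDiff_const.mul (h.pow 2))).add this

/-- Local conservation of energy. -/
lemma SmoothSol.pd_en {m : ℝ} {V : Polynomial ℝ} {Φ : ℝ × E3 → ℝ} (h : SmoothSol m V Φ)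
    (p : ℝ × E3) :
    pd e0 (en m V Φ) p = ∑ j, pd (ej j) (fun q => pd e0 Φ q * pd (ej j) Φ q) p := by
  obtain ⟨hs, he⟩ := h
  have h0 := hs.dir (v := e0)
  have hj : ∀ j, Smooth (pd (ej j) Φ) := fun j => hs.dir
  have hsum : Smooth (fun q => ∑ j, pd (ej j) Φ q ^ 2) := ContDiff.sum fun j _ => (hj j).pow 2
  have e1 : pd e0 (en m V Φ) p = pd e0 Φ p * pd e0 (pd e0 Φ) p
      + ∑ j, pd (ej j) Φ p * pd e0 (pd (ej j) Φ) p + m ^ 2 * Φ p * pd e0 Φ p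
      + (derivative V).eval (Φ p) * pd e0 Φ p := by
    unfold en
    rw [pd_add (((contDiff_const.mul (h0.pow 2)).add (contDiff_const.mul hsum)).add
        (contDiff_const.mul (hs.pow 2))) (hs.eval V),
      pd_add ((contDiff_const.mul (h0.pow 2)).add (contDiff_const.mul hsum))
        (contDiff_const.mul (hs.pow 2)),
      pd_add (contDiff_const.mul (h0.pow 2)) (contDiff_const.mul hsum),
      pd_const_mul _ (h0.pow 2), pd_const_mul _ hsum, pd_const_mul _ (hs.pow 2),
      pd_sq h0, pd_sq hs, pd_eval V hs, pd_sum _ fun j => (hj j).pow 2]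
    simp only [pd_sq (hj _)]
    rw [Finset.sum_congr rfl fun j _ => mul_assoc 2 _ _, ← Finset.mul_sum]
    ring
  have e2 : ∀ j, pd (ej j) (fun q => pd e0 Φ q * pd (ej j) Φ q) p
      = pd (ej j) Φ p * pd e0 (pd (ej j) Φ) p + pd e0 Φ p * pd (ej j) (pd (ej j) Φ) p := by
    intro j
    rw [pd_mul h0 (hj j), pd_comm hs (v := ej j) (w := e0)]
    ring
  rw [e1, Finset.sum_congr rfl fun j _ => e2 j, Finset.sum_add_distrib, ← Finset.mul_sum]
  linear_combination pd e0 Φ p * he p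

/-- Functions whose spatial support is bounded, locally uniformly in time. -/
def SpaceSupp (Q : ℝ × E3 → ℝ) : Prop :=
  ∀ T : ℝ, ∃ R : ℝ, ∀ (t : ℝ) (x : E3), |t| ≤ T → R ≤ ‖x‖ → Q (t, x) = 0

namespace SpaceSupp

variable {Q : ℝ × E3 → ℝ}

lemma mul_right (h : SpaceSupp Q) (f : ℝ × E3 → ℝ) : SpaceSupp (fun p => Q p * f p) := by
  intro T
  obtain ⟨R, hR⟩ := h T
  exact ⟨R, fun t x ht hx => by simp [hR t x ht hx]⟩

lemma dir (h : SpaceSupp Q) (v : ℝ × E3) : SpaceSupp (pd v Q) := by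
  intro T
  obtain ⟨R, hR⟩ := h (T + 1)
  refine ⟨R + 1, fun t x ht hx => ?_⟩
  have hev : Q =ᶠ[𝓝 (t, x)] fun _ => 0 := by
    have h1 : ∀ᶠ q : ℝ × E3 in 𝓝 (t, x), |q.1| < T + 1 :=
      (continuous_abs.comp continuous_fst).continuousAt.eventually_lt continuousAt_const
        (by simpa using by linarith)
    have h2 : ∀ᶠ q : ℝ × E3 in 𝓝 (t, x), R < ‖q.2‖ :=
      continuousAt_const.eventually_lt (continuous_norm.comp continuous_snd).continuousAt
        (by simpa using by linarith)
    filter_upwards [h1, h2] with q hq1 hq2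
    exact hR q.1 q.2 hq1.le hq2.le
  simp [pd, hev.fderiv_eq]

lemma hasCompactSupport (h : SpaceSupp Q) (t : ℝ) : HasCompactSupport (fun x => Q (t, x)) := by
  obtain ⟨R, hR⟩ := h |t|
  refine HasCompactSupport.intro (isCompact_closedBall 0 R) fun x hx => ?_
  exact hR t x le_rfl (by simpa using hx : R < ‖x‖).le

lemma integrable (h : SpaceSupp Q) (hc : Continuous Q) (t : ℝ) :
    Integrable (fun x => Q (t, x)) :=
  (hc.comp (by fun_prop : Continuous fun x : E3 => (t, x))).integrable_of_hasCompactSupport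
    (h.hasCompactSupport t)

lemma integral_dir_space (h : SpaceSupp Q) (hQ : Smooth Q) (t : ℝ) (j : Fin 3) :
    ∫ x, pd (ej j) Q (t, x) = 0 := by
  have key := integral_bilinear_hasLineDerivAt_right_eq_neg_left_of_integrable
    (μ := (volume : Measure E3)) (f := fun _ : E3 => (1 : ℝ)) (f' := fun _ => 0)
    (g := fun x => Q (t, x)) (g' := fun x => pd (ej j) Q (t, x))
    (v := EuclideanSpace.single j 1) (B := ContinuousLinearMap.mul ℝ ℝ)
    (by simp) (by simpa using (h.dir _).integrable hQ.dir.continuous t)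
    (by simpa using h.integrable hQ.continuous t)
    (fun x _ => by simpa using (hasFDerivAt_const (1 : ℝ) x).hasLineDerivAt _)
    (fun x _ => by
      simpa using! hasDerivAt_space_line hQ t x (EuclideanSpace.single j 1) 0)
  simpa using key

lemma hasDerivAt_integral (h : SpaceSupp Q) (hQ : Smooth Q) (t : ℝ) :
    HasDerivAt (fun s => ∫ x, Q (s, x)) (∫ x, pd e0 Q (t, x)) t := by
  obtain ⟨R, hR⟩ := h.dir e0 (|t| + 1)
  obtain ⟨M, hM⟩ := ((isCompact_Icc (a := t - 1) (b := t + 1)).prod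
    (isCompact_closedBall (0 : E3) R)).exists_bound_of_continuousOn
      (hQ.dir (v := e0)).continuous.continuousOn
  refine (hasDerivAt_integral_of_dominated_loc_of_deriv_le
    (F := fun s x => Q (s, x)) (F' := fun s x => pd e0 Q (s, x))
    (bound := (Metric.closedBall (0 : E3) R).indicator fun _ => M)
    (Icc_mem_nhds (by linarith : t - 1 < t) (by linarith : t < t + 1)) ?_ ?_ ?_ ?_ ?_ ?_).2
  · exact .of_forall fun s => (h.integrable hQ.continuous s).aestronglyMeasurable
  · exact h.integrable hQ.continuous t
  · exact ((h.dir e0).integrable hQ.dir.continuous t).aestronglyMeasurable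
  · refine .of_forall fun x s hs => ?_
    by_cases hx : x ∈ Metric.closedBall (0 : E3) R
    · rw [Set.indicator_of_mem hx]
      exact hM (s, x) ⟨hs, hx⟩
    · have hs' : |s| ≤ |t| + 1 := by
        have : |s - t| ≤ 1 := abs_le.2 ⟨by linarith [hs.1], by linarith [hs.2]⟩
        linarith [abs_sub_abs_le_abs_sub s t]
      rw [Set.indicator_of_notMem hx, hR s x hs' (by simpa using hx : R < ‖x‖).le, norm_zero]
  · exact (integrable_indicator_iff measurableSet_closedBall).2
      (integrableOn_const (measure_closedBall_lt_top).ne)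
  · refine .of_forall fun x s _ => ?_
    have h : HasDerivAt (fun s : ℝ => ((s, x) : ℝ × E3)) (1, 0) s :=
      (hasDerivAt_id s).prodMk (hasDerivAt_const s x)
    exact (hQ.diff (s, x)).hasFDerivAt.comp_hasDerivAt s h

end SpaceSupp

/-- The smoothed norm `√(1 + ‖x‖²)`. -/
def jb (x : E3) : ℝ := √(1 + ‖x‖ ^ 2)

lemma norm_le_jb (x : E3) : ‖x‖ ≤ jb x := Real.le_sqrt_of_sq_le (by linarith)

lemma hasDerivAt_jb_line (x v : E3) :
    HasDerivAt (fun s : ℝ => jb (x + s • v)) (inner ℝ x v / jb x) 0 := by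
  have h1 : HasDerivAt (fun s : ℝ => x + s • v) v 0 := by
    simpa using ((hasDerivAt_id (0 : ℝ)).smul_const v).const_add x
  have h2 := ((h1.norm_sq.const_add 1).sqrt (by positivity))
  refine h2.congr_deriv ?_
  simp [jb]
  ring

/-- A cutoff equal to `1` well inside the cone `‖x‖ < R - a t` and vanishing outside it. -/
def cut (a R : ℝ) (p : ℝ × E3) : ℝ := Real.smoothTransition (R - a * p.1 - jb p.2)

lemma smooth_cut (a R : ℝ) : Smooth (cut a R) := by
  have h1 : Smooth fun p : ℝ × E3 => jb p.2 := by
    unfold jb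
    exact ContDiff.sqrt (contDiff_const.add (contDiff_snd.norm_sq ℝ)) fun p => by positivity
  exact Real.smoothTransition.contDiff.comp
    ((contDiff_const.sub (contDiff_const.mul contDiff_fst)).sub h1)

lemma cut_nonneg (a R : ℝ) (p : ℝ × E3) : 0 ≤ cut a R p := Real.smoothTransition.nonneg _

lemma cut_le_one (a R : ℝ) (p : ℝ × E3) : cut a R p ≤ 1 := Real.smoothTransition.le_one _

lemma tendsto_cut (a : ℝ) (p : ℝ × E3) : Tendsto (fun n : ℕ => cut a n p) atTop (𝓝 1) := by
  refine tendsto_const_nhds.congr' ?_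
  filter_upwards [tendsto_natCast_atTop_atTop.eventually_ge_atTop (a * p.1 + jb p.2 + 1)] with n hn
  exact (Real.smoothTransition.one_of_one_le (by linarith)).symm

lemma spaceSupp_cut (a R : ℝ) : SpaceSupp (cut a R) := by
  intro T
  refine ⟨R + |a| * T, fun t x ht hx => Real.smoothTransition.zero_of_nonpos ?_⟩
  have h1 : |a * t| ≤ |a| * T := by
    rw [abs_mul]; gcongr
  have := norm_le_jb x
  have := neg_abs_le (a * t)
  simp only
  linarith

lemma hasDerivAt_smoothTransition (s : ℝ) :
    HasDerivAt Real.smoothTransition (deriv Real.smoothTransition s) s :=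
  ((Real.smoothTransition.contDiff (n := 1)).differentiable (by simp) s).hasDerivAt

lemma deriv_smoothTransition_nonneg (s : ℝ) : 0 ≤ deriv Real.smoothTransition s :=
  Real.smoothTransition.monotone.deriv_nonneg

lemma exists_deriv_smoothTransition_le :
    ∃ c : ℝ, 0 ≤ c ∧ ∀ s, deriv Real.smoothTransition s ≤ c := by
  obtain ⟨M, hM⟩ := (isCompact_Icc (a := (0 : ℝ)) (b := 1)).exists_bound_of_continuousOn
    ((Real.smoothTransition.contDiff (n := 1)).continuous_deriv le_rfl).continuousOn
  refine ⟨M, (norm_nonneg _).trans (hM 0 (by simp)), fun s => ?_⟩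
  by_cases hs : s ∈ Set.Icc (0 : ℝ) 1
  · exact (le_abs_self _).trans (hM s hs)
  · have h0 : 0 ≤ M := (norm_nonneg _).trans (hM 0 (by simp))
    have : deriv Real.smoothTransition s = 0 := by
      rw [Set.mem_Icc, not_and_or, not_le, not_le] at hs
      rcases hs with hs | hs
      · have : Real.smoothTransition =ᶠ[𝓝 s] fun _ => 0 := by
          filter_upwards [Iio_mem_nhds hs] with u hu
          exact Real.smoothTransition.zero_of_nonpos (le_of_lt hu)
        simp [this.deriv_eq]
      · have : Real.smoothTransition =ᶠ[𝓝 s] fun _ => 1 := by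
          filter_upwards [Ioi_mem_nhds hs] with u hu
          exact Real.smoothTransition.one_of_one_le (le_of_lt hu)
        simp [this.deriv_eq]
    rw [this]; exact h0

/-- The radial derivative of `cut`, up to sign. -/
def cutSlope (a R : ℝ) (p : ℝ × E3) : ℝ :=
  deriv Real.smoothTransition (R - a * p.1 - jb p.2)

lemma pd_e0_cut (a R : ℝ) (p : ℝ × E3) : pd e0 (cut a R) p = -a * cutSlope a R p := by
  obtain ⟨t, x⟩ := p
  rw [← timeDeriv_eq_pd (smooth_cut a R)]
  have h : HasDerivAt (fun s : ℝ => R - a * s - jb x) (-a) t := by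
    simpa using (((hasDerivAt_id t).const_mul a).const_sub R).sub_const (jb x)
  refine ((hasDerivAt_smoothTransition _).comp t h).deriv.trans ?_
  simp [cutSlope]; ring

lemma pd_ej_cut (a R : ℝ) (p : ℝ × E3) (j : Fin 3) :
    pd (ej j) (cut a R) p = -(cutSlope a R p * (p.2 j / jb p.2)) := by
  obtain ⟨t, x⟩ := p
  have h0 := (hasDerivAt_space_line (smooth_cut a R) t x (EuclideanSpace.single j 1) 0).deriv
  have h1 := (hasDerivAt_jb_line x (EuclideanSpace.single j 1)).const_sub (R - a * t)
  have h2 := ((hasDerivAt_smoothTransition _).comp (0 : ℝ) h1).deriv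
  have h3 := h0.symm.trans h2
  rw [zero_smul, add_zero] at h3
  refine Eq.trans h3 ?_
  simp [cutSlope, EuclideanSpace.inner_single_right]

lemma sum_div_jb_sq_le (x : E3) : ∑ j, (x j / jb x) ^ 2 ≤ 1 := by
  have h1 : jb x ^ 2 = 1 + ‖x‖ ^ 2 := Real.sq_sqrt (by positivity)
  have h2 : ‖x‖ ^ 2 = ∑ j, x j ^ 2 := by simp [EuclideanSpace.norm_sq_eq]
  simp only [div_pow]
  rw [← Finset.sum_div, ← h2, h1, div_le_one (by positivity)]
  linarith

lemma SmoothSol.antitone_integral_cut_mul_en {m : ℝ} {V : Polynomial ℝ} {Φ : ℝ × E3 → ℝ}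
    (h : SmoothSol m V Φ) (hV : ∀ s, 0 ≤ V.eval s) (R : ℝ) :
    Antitone fun t => ∫ x, cut 1 R (t, x) * en m V Φ (t, x) := by
  have hs := h.1
  have hc := smooth_cut 1 R
  have hQ : Smooth fun p => cut 1 R p * en m V Φ p := hc.mul hs.energy
  have hQs : SpaceSupp fun p => cut 1 R p * en m V Φ p := (spaceSupp_cut 1 R).mul_right _
  have h0 := hs.dir (v := e0)
  have hj : ∀ j, Smooth (pd (ej j) Φ) := fun j => hs.dir
  have hF : ∀ j, Smooth fun p => cut 1 R p * (pd e0 Φ p * pd (ej j) Φ p) :=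
    fun j => hc.mul (h0.mul (hj j))
  have hFs : ∀ j, SpaceSupp fun p => cut 1 R p * (pd e0 Φ p * pd (ej j) Φ p) :=
    fun j => (spaceSupp_cut 1 R).mul_right _
  refine antitone_of_hasDerivAt_nonpos (fun t => hQs.hasDerivAt_integral hQ t) fun t => ?_
  have hsplit : ∫ x, pd e0 (fun p => cut 1 R p * en m V Φ p) (t, x) =
      ∫ x, (pd e0 (fun p => cut 1 R p * en m V Φ p) (t, x) -
        ∑ j, pd (ej j) (fun p => cut 1 R p * (pd e0 Φ p * pd (ej j) Φ p)) (t, x)) := by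
    have hi : ∀ j ∈ (Finset.univ : Finset (Fin 3)), Integrable fun x =>
        pd (ej j) (fun p => cut 1 R p * (pd e0 Φ p * pd (ej j) Φ p)) (t, x) :=
      fun j _ => ((hFs j).dir _).integrable (hF j).dir.continuous t
    rw [integral_sub ((hQs.dir _).integrable hQ.dir.continuous t) (integrable_finsetSum _ hi),
      integral_finsetSum _ hi,
      Finset.sum_eq_zero fun j _ => (hFs j).integral_dir_space (hF j) t j, sub_zero]
  simp only [hsplit]
  refine integral_nonpos fun x => ?_
  simp only [Pi.zero_apply]
  rw [pd_mul hc hs.energy, h.pd_en, pd_e0_cut]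
  simp only [pd_mul hc (h0.mul (hj _)), pd_ej_cut]
  rw [Finset.sum_add_distrib, ← Finset.mul_sum]
  have hk : 0 ≤ cutSlope 1 R (t, x) := deriv_smoothTransition_nonneg _
  set k := cutSlope 1 R (t, x)
  have e1 : ∑ j, -(k * (x j / jb x)) * (pd e0 Φ (t, x) * pd (ej j) Φ (t, x)) =
      -(k * (pd e0 Φ (t, x) * ∑ j, (x j / jb x) * pd (ej j) Φ (t, x))) := by
    simp only [Finset.mul_sum, ← Finset.sum_neg_distrib]
    exact Finset.sum_congr rfl fun j _ => by ring
  have e2 := Finset.sum_mul_sq_le_sq_mul_sq Finset.univ (fun j => x j / jb x)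
    (fun j => pd (ej j) Φ (t, x))
  have e3 := sum_div_jb_sq_le x
  have e4 : 0 ≤ ∑ j, pd (ej j) Φ (t, x) ^ 2 := Finset.sum_nonneg fun j _ => sq_nonneg _
  rw [e1]
  have e5 : pd e0 Φ (t, x) * (∑ j, (x j / jb x) * pd (ej j) Φ (t, x)) ≤ en m V Φ (t, x) := by
    have := hV (Φ (t, x))
    have e6 : (∑ j, (x j / jb x) * pd (ej j) Φ (t, x)) ^ 2 ≤ ∑ j, pd (ej j) Φ (t, x) ^ 2 :=
      e2.trans (mul_le_of_le_one_left e4 e3)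
    have : 0 ≤ (1 / 2) * m ^ 2 * Φ (t, x) ^ 2 := by positivity
    unfold en
    nlinarith [sq_nonneg (pd e0 Φ (t, x) - ∑ j, (x j / jb x) * pd (ej j) Φ (t, x))]
  nlinarith [mul_le_mul_of_nonneg_left e5 hk]

/-- Square integrability of a space-time function at time `t`. -/
abbrev L2At (t : ℝ) (f : ℝ × E3 → ℝ) : Prop := MemLp (fun x => f (t, x)) 2

lemma SchwartzData.memLp {Φ : ℝ × E3 → ℝ} (h : SchwartzData Φ) (t : ℝ) : L2At t Φ := by
  obtain ⟨⟨g, hg⟩, -⟩ := h t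
  exact (g.memLp 2).ae_eq (.of_forall hg)

lemma SchwartzData.memLp_e0 {Φ : ℝ × E3 → ℝ} (h : SchwartzData Φ) (t : ℝ) :
    L2At t (pd e0 Φ) := by
  obtain ⟨-, ⟨g, hg⟩⟩ := h t
  exact (g.memLp 2).ae_eq (.of_forall hg)

lemma SchwartzData.memLp_ej {Φ : ℝ × E3 → ℝ} (h : SchwartzData Φ) (hs : Smooth Φ) (t : ℝ)
    (j : Fin 3) : L2At t (pd (ej j) Φ) := by
  obtain ⟨⟨g, hg⟩, -⟩ := h t
  refine ((LineDeriv.lineDerivOp (EuclideanSpace.single j (1 : ℝ)) g :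
    SchwartzMap E3 ℝ).memLp 2).ae_eq (.of_forall fun x => ?_)
  rw [SchwartzMap.lineDerivOp_apply_eq_fderiv, show (g : E3 → ℝ) = fun y => Φ (t, y) from funext hg]
  exact fderiv_slice hs t x _

/-- A polynomial with a double zero at the origin is integrable along Schwartz functions. -/
lemma SchwartzData.integrable_eval {Φ : ℝ × E3 → ℝ} (h : SchwartzData Φ) (t : ℝ)
    {V : Polynomial ℝ} (hV : X ^ 2 ∣ V) : Integrable fun x => V.eval (Φ (t, x)) := by
  obtain ⟨W, rfl⟩ := hV
  have h2 := (h.memLp t).integrable_sq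
  obtain ⟨⟨g, hg⟩, -⟩ := h t
  simp only [← hg] at h2 ⊢
  obtain ⟨C, hC⟩ : ∃ C, ∀ x, ‖g x‖ ≤ C :=
    ⟨‖g.toBoundedContinuousFunction‖, fun x => g.toBoundedContinuousFunction.norm_coe_le_norm x⟩
  obtain ⟨M, hM⟩ := (isCompact_Icc (a := -C) (b := C)).exists_bound_of_continuousOn
    W.continuous.continuousOn
  have := h2.mul_bdd (c := M) (g := fun x => W.eval (g x))
    (W.continuous.comp g.continuous).aestronglyMeasurable
    (.of_forall fun x => hM _ (abs_le.1 (hC x)))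
  simpa using this

lemma SchwartzData.integrable_en {m : ℝ} {V : Polynomial ℝ} {Φ : ℝ × E3 → ℝ}
    (h : SchwartzData Φ) (hs : Smooth Φ) (hV : X ^ 2 ∣ V) (t : ℝ) :
    Integrable fun x => en m V Φ (t, x) := by
  have h1 := (h.memLp t).integrable_sq
  have h2 := (h.memLp_e0 t).integrable_sq
  have h3 := fun j => (h.memLp_ej hs t j).integrable_sq
  exact (((h2.const_mul _).add ((integrable_finsetSum _ fun j _ => h3 j).const_mul _)).add
    (h1.const_mul _)).add (h.integrable_eval t hV)

lemma SmoothSol.antitone_integral_en {m : ℝ} {V : Polynomial ℝ} {Φ : ℝ × E3 → ℝ}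
    (h : SmoothSol m V Φ) (hd : SchwartzData Φ) (hV : ∀ s, 0 ≤ V.eval s) (hV2 : X ^ 2 ∣ V) :
    Antitone fun t => ∫ x, en m V Φ (t, x) := by
  intro s t hst
  have hi := fun t => hd.integrable_en (m := m) h.1 hV2 t
  have hle : ∀ (R : ℝ) (p : ℝ × E3), cut 1 R p * en m V Φ p ≤ en m V Φ p := fun R p =>
    mul_le_of_le_one_left (en_nonneg hV Φ p) (cut_le_one _ _ _)
  have hii : ∀ (R t : ℝ), Integrable fun x => cut 1 R (t, x) * en m V Φ (t, x) := fun R t =>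
    ((spaceSupp_cut 1 R).mul_right _).integrable
      ((smooth_cut 1 R).continuous.mul h.1.energy.continuous) t
  have hlim : Tendsto (fun n : ℕ => ∫ x, cut 1 n (t, x) * en m V Φ (t, x)) atTop
      (𝓝 (∫ x, en m V Φ (t, x))) := by
    refine tendsto_integral_of_dominated_convergence _
      (fun n => (hii n t).aestronglyMeasurable) (hi t) (fun n => .of_forall fun x => ?_)
      (.of_forall fun x => ?_)
    · rw [Real.norm_of_nonneg (mul_nonneg (cut_nonneg _ _ _) (en_nonneg hV Φ _))]
      exact hle _ _
    · simpa using (tendsto_cut 1 (t, x)).mul_const (en m V Φ (t, x))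
  refine le_of_tendsto hlim (.of_forall fun n => ?_)
  exact (h.antitone_integral_cut_mul_en hV n hst).trans
    (integral_mono (hii n s) (hi s) fun x => hle n (s, x))

/-- Time reversal. -/
def rev (Φ : ℝ × E3 → ℝ) : ℝ × E3 → ℝ := fun p => Φ (-p.1, p.2)

lemma pd_rev {Φ : ℝ × E3 → ℝ} (hs : Smooth Φ) (v p : ℝ × E3) :
    pd v (rev Φ) p = pd (-v.1, v.2) Φ (-p.1, p.2) := by
  have h : HasFDerivAt (fun q : ℝ × E3 => (-q.1, q.2))
      ((-ContinuousLinearMap.fst ℝ ℝ E3).prod (ContinuousLinearMap.snd ℝ ℝ E3)) p :=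
    (hasFDerivAt_fst.neg).prodMk hasFDerivAt_snd
  have := ((hs.diff (-p.1, p.2)).hasFDerivAt.comp p h).fderiv
  simp only [pd]
  rw [show rev Φ = Φ ∘ fun q : ℝ × E3 => (-q.1, q.2) from rfl, this]
  simp

lemma Smooth.rev {Φ : ℝ × E3 → ℝ} (hs : Smooth Φ) : Smooth (rev Φ) :=
  hs.comp (contDiff_fst.neg.prodMk contDiff_snd)

lemma pd_e0_rev {Φ : ℝ × E3 → ℝ} (hs : Smooth Φ) (p : ℝ × E3) :
    pd e0 (rev Φ) p = -rev (pd e0 Φ) p := by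
  rw [pd_rev hs]
  simp only [e0, rev, pd]
  rw [← map_neg]
  simp

lemma pd_ej_rev {Φ : ℝ × E3 → ℝ} (hs : Smooth Φ) (j : Fin 3) :
    pd (ej j) (rev Φ) = rev (pd (ej j) Φ) := by
  funext p
  rw [pd_rev hs]
  simp [ej, rev]

lemma SmoothSol.rev {m : ℝ} {V : Polynomial ℝ} {Φ : ℝ × E3 → ℝ} (h : SmoothSol m V Φ) :
    SmoothSol m V (rev Φ) := by
  refine ⟨h.1.rev, fun p => ?_⟩
  have h00 : pd e0 (pd e0 (_root_.rev Φ)) p = _root_.rev (pd e0 (pd e0 Φ)) p := by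
    rw [show pd e0 (_root_.rev Φ) = fun q => (-1) * _root_.rev (pd e0 Φ) q from
      funext fun q => by rw [pd_e0_rev h.1]; ring]
    rw [pd_const_mul _ h.1.dir.rev, pd_e0_rev h.1.dir]
    ring
  simp only [h00, pd_ej_rev h.1, pd_ej_rev h.1.dir]
  exact h.2 (-p.1, p.2)

lemma SchwartzData.rev {Φ : ℝ × E3 → ℝ} (h : SchwartzData Φ) (hs : Smooth Φ) :
    SchwartzData (rev Φ) := by
  intro t
  obtain ⟨⟨g, hg⟩, ⟨k, hk⟩⟩ := h (-t)
  exact ⟨⟨g, hg⟩, ⟨-k, fun x => by rw [pd_e0_rev hs]; simp [hk, _root_.rev]⟩⟩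

lemma en_rev {m : ℝ} {V : Polynomial ℝ} {Φ : ℝ × E3 → ℝ} (hs : Smooth Φ) (p : ℝ × E3) :
    en m V (rev Φ) p = en m V Φ (-p.1, p.2) := by
  simp only [en, pd_e0_rev hs, pd_ej_rev hs]
  simp [rev]

/-- Conservation of energy. -/
lemma SmoothSol.integral_en_eq {m : ℝ} {V : Polynomial ℝ} {Φ : ℝ × E3 → ℝ}
    (h : SmoothSol m V Φ) (hd : SchwartzData Φ) (hV : ∀ s, 0 ≤ V.eval s) (hV2 : X ^ 2 ∣ V)
    (s t : ℝ) : ∫ x, en m V Φ (s, x) = ∫ x, en m V Φ (t, x) := by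
  have key : ∀ s t : ℝ, s ≤ t → ∫ x, en m V Φ (s, x) = ∫ x, en m V Φ (t, x) := by
    intro s t hst
    refine le_antisymm ?_ (h.antitone_integral_en hd hV hV2 hst)
    have := h.rev.antitone_integral_en (hd.rev h.1) hV hV2 (neg_le_neg hst)
    simpa [en_rev h.1] using this
  rcases le_total s t with hst | hst
  · exact key s t hst
  · exact (key t s hst).symm

/-- A linear solution with vanishing Cauchy data vanishes in the future. -/
lemma SmoothSol.eq_zero_of_data {m : ℝ} (hm : 0 < m) {Φ : ℝ × E3 → ℝ} (h : SmoothSol m 0 Φ)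
    (h0 : ∀ x, Φ (0, x) = 0) (h1 : ∀ x, pd e0 Φ (0, x) = 0) {t : ℝ} (ht : 0 ≤ t) (x : E3) :
    Φ (t, x) = 0 := by
  have hV : ∀ s : ℝ, 0 ≤ (0 : Polynomial ℝ).eval s := by simp
  have hz : ∀ x, en m 0 Φ (0, x) = 0 := by
    intro x
    have hj : ∀ j, pd (ej j) Φ (0, x) = 0 := by
      intro j
      rw [ej, ← fderiv_slice h.1, show (fun y => Φ (0, y)) = fun _ => 0 from funext h0]
      simp
    simp [en, h0, h1, hj]
  obtain ⟨n, hn⟩ := exists_nat_ge (t + jb x + 1)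
  have hc : Continuous fun x => cut 1 n (t, x) * en m 0 Φ (t, x) :=
    ((smooth_cut 1 n).continuous.mul h.1.energy.continuous).comp (by fun_prop)
  have hle : ∫ x, cut 1 n (t, x) * en m 0 Φ (t, x) ≤ 0 := by
    simpa [hz] using h.antitone_integral_cut_mul_en hV n ht
  have hpos : 0 ≤ fun x => cut 1 n (t, x) * en m 0 Φ (t, x) := fun x =>
    mul_nonneg (cut_nonneg _ _ _) (en_nonneg hV _ _)
  have hint : Integrable fun x => cut 1 n (t, x) * en m 0 Φ (t, x) :=
    ((spaceSupp_cut 1 n).mul_right _).integrable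
      ((smooth_cut 1 n).continuous.mul h.1.energy.continuous) t
  have hae := (integral_eq_zero_iff_of_nonneg hpos hint).1
    (le_antisymm hle (integral_nonneg hpos))
  have hx := congrFun (hc.ae_eq_iff_eq volume continuous_zero |>.1 hae) x
  have hcut : cut 1 n (t, x) = 1 := Real.smoothTransition.one_of_one_le (by simp; linarith)
  simp only [hcut, one_mul, Pi.zero_apply] at hx
  have h3 : 0 ≤ ∑ j, pd (ej j) Φ (t, x) ^ 2 := Finset.sum_nonneg fun j _ => sq_nonneg _
  have h4 : (1 / 2) * m ^ 2 * Φ (t, x) ^ 2 ≤ 0 := by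
    simp only [en, eval_zero] at hx
    nlinarith [sq_nonneg (pd e0 Φ (t, x))]
  have h5 : Φ (t, x) ^ 2 ≤ 0 := by
    by_contra hcon
    push Not at hcon
    have : 0 < (1 / 2) * m ^ 2 * Φ (t, x) ^ 2 := by positivity
    linarith
  nlinarith [sq_nonneg (Φ (t, x))]

section OscillatoryIntegrals

open scoped ComplexConjugate ContDiff

/-- The character `r ↦ exp (2 π i r)`. -/
def chr (r : ℝ) : ℂ := (Real.fourierChar r : ℂ)

@[simp] lemma norm_chr (r : ℝ) : ‖chr r‖ = 1 := Circle.norm_coe _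

lemma chr_eq_exp (r : ℝ) : chr r = Complex.exp ((2 * Real.pi * r : ℝ) * Complex.I) :=
  Real.fourierChar_apply r

lemma chr_add (r s : ℝ) : chr (r + s) = chr r * chr s := by
  simp [chr, AddChar.map_add_eq_mul]

lemma conj_chr (r : ℝ) : conj (chr r) = chr (-r) := by
  rw [chr_eq_exp, chr_eq_exp, ← Complex.exp_conj]
  congr 1
  rw [map_mul, Complex.conj_ofReal, Complex.conj_I]
  push_cast
  ring

lemma contDiff_chr : ContDiff ℝ ∞ chr := by
  have : chr = fun r : ℝ => Complex.exp ((2 * Real.pi * r : ℝ) * Complex.I) := funext chr_eq_exp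
  rw [this]
  exact ((Complex.ofRealCLM.contDiff.comp (contDiff_const.mul contDiff_id)).mul
    contDiff_const).cexp

lemma fderiv_chr_comp {g : E3 → ℝ} (hg : Differentiable ℝ g) (ξ h : E3) :
    fderiv ℝ (fun η => chr (g η)) ξ h
      = 2 * Real.pi * Complex.I * (fderiv ℝ g ξ h : ℂ) * chr (g ξ) := by
  have h1 := (Real.hasDerivAt_fourierChar (g ξ)).hasFDerivAt.comp ξ (hg ξ).hasFDerivAt
  have h2 : fderiv ℝ (fun η => chr (g η)) ξ = _ := HasFDerivAt.fderiv h1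
  rw [h2]
  simp [chr]
  ring

/-- The Riemann-Lebesgue lemma for phases without critical points. -/
lemma tendsto_integral_chr_mul {g : E3 → ℝ} (hg : ContDiff ℝ ∞ g) {h : E3}
    (hgh : ∀ ξ, fderiv ℝ g ξ h ≠ 0) {F : E3 → ℂ} (hF : ContDiff ℝ ∞ F)
    (hFc : HasCompactSupport F) :
    Tendsto (fun t : ℝ => ∫ ξ, chr (t * g ξ) * F ξ) atTop (𝓝 0) := by
  set d : E3 → ℂ := fun ξ => (fderiv ℝ g ξ h : ℂ) with hd
  have hds : ContDiff ℝ ∞ d := Complex.ofRealCLM.contDiff.comp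
    ((hg.fderiv_right (m := ∞) (by simp)).clm_apply contDiff_const)
  have hd0 : ∀ ξ, d ξ ≠ 0 := fun ξ => by simpa [hd] using hgh ξ
  set G : E3 → ℂ := fun ξ => F ξ * (d ξ)⁻¹ with hG
  have hGs : ContDiff ℝ ∞ G := hF.mul (hds.inv hd0)
  have hGc : HasCompactSupport G := hFc.mul_right
  have hG1 : Continuous fun ξ => fderiv ℝ G ξ h :=
    ((hGs.fderiv_right (m := ∞) (by simp)).clm_apply contDiff_const).continuous
  have hG1c : HasCompactSupport fun ξ => fderiv ℝ G ξ h :=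
    (hGc.fderiv (𝕜 := ℝ)).comp_left (g := fun L : E3 →L[ℝ] ℂ => L h) (by simp)
  have hcs : ∀ t : ℝ, ContDiff ℝ ∞ fun ξ => chr (t * g ξ) := fun t =>
    contDiff_chr.comp (contDiff_const.mul hg)
  have hder : ∀ (t : ℝ) (ξ : E3), fderiv ℝ (fun η => chr (t * g η)) ξ h * G ξ
      = 2 * Real.pi * Complex.I * t * (chr (t * g ξ) * F ξ) := by
    intro t ξ
    rw [fderiv_chr_comp ((contDiff_const.mul hg).differentiable (by simp)),
      fderiv_const_mul (hg.differentiable (by simp) ξ)]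
    have := hd0 ξ
    simp only [hG, hd, smul_apply, smul_eq_mul, Complex.ofReal_mul] at this ⊢
    field_simp
  have key : ∀ t : ℝ, ∫ ξ, chr (t * g ξ) * fderiv ℝ G ξ h
      = -(2 * Real.pi * Complex.I * t * ∫ ξ, chr (t * g ξ) * F ξ) := by
    intro t
    rw [integral_mul_fderiv_eq_neg_fderiv_mul_of_integrable]
    · simp_rw [hder, integral_const_mul]
    · simp_rw [hder]
      exact (((hcs t).continuous.mul hF.continuous).integrable_of_hasCompactSupport
        hFc.mul_left).const_mul _
    · exact ((hcs t).continuous.mul hG1).integrable_of_hasCompactSupport hG1c.mul_left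
    · exact ((hcs t).continuous.mul hGs.continuous).integrable_of_hasCompactSupport hGc.mul_left
    · exact fun ξ _ => (hcs t).differentiable (by simp) ξ
    · exact fun ξ _ => hGs.differentiable (by simp) ξ
  have hlim : Tendsto (fun t : ℝ => (∫ ξ, ‖fderiv ℝ G ξ h‖) / (2 * Real.pi * t)) atTop (𝓝 0) :=
    tendsto_const_nhds.div_atTop (tendsto_id.const_mul_atTop (by positivity))
  refine squeeze_zero_norm' ?_ hlim
  filter_upwards [eventually_gt_atTop 0] with t ht
  rw [le_div_iff₀ (by positivity)]
  calc ‖∫ ξ, chr (t * g ξ) * F ξ‖ * (2 * Real.pi * t)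
      = ‖∫ ξ, chr (t * g ξ) * fderiv ℝ G ξ h‖ := by
        rw [key, norm_neg, norm_mul]
        simp [abs_of_pos ht, abs_of_pos Real.pi_pos]
        ring
    _ ≤ ∫ ξ, ‖chr (t * g ξ) * fderiv ℝ G ξ h‖ := norm_integral_le_integral_norm _
    _ = _ := by simp

/-- The frequency `√(κ² + ‖ξ‖²)`. -/
def freq (κ : ℝ) (ξ : E3) : ℝ := Real.sqrt (κ ^ 2 + ‖ξ‖ ^ 2)

lemma freq_sq (κ : ℝ) (ξ : E3) : freq κ ξ ^ 2 = κ ^ 2 + ‖ξ‖ ^ 2 := Real.sq_sqrt (by positivity)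

lemma freq_pos {κ : ℝ} (hκ : 0 < κ) (ξ : E3) : 0 < freq κ ξ := Real.sqrt_pos.2 (by positivity)

lemma contDiff_freq {κ : ℝ} (hκ : 0 < κ) : ContDiff ℝ ∞ (freq κ) :=
  (contDiff_const.add (contDiff_norm_sq ℝ)).sqrt fun ξ => by positivity

lemma fderiv_freq {κ : ℝ} (hκ : 0 < κ) (ξ h : E3) :
    fderiv ℝ (freq κ) ξ h = inner ℝ ξ h / freq κ ξ := by
  have h1 : HasFDerivAt (fun ξ : E3 => κ ^ 2 + ‖ξ‖ ^ 2) (2 • innerSL ℝ ξ) ξ :=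
    (hasStrictFDerivAt_norm_sq ξ).hasFDerivAt.const_add _
  have h2 := h1.sqrt (by positivity : κ ^ 2 + ‖ξ‖ ^ 2 ≠ 0)
  have h3 : fderiv ℝ (freq κ) ξ = _ := h2.fderiv
  rw [h3]
  have := freq_pos hκ ξ
  simp [freq] at this ⊢
  field_simp

/-- Differences of the frequency have no critical points. -/
lemma fderiv_freq_sub_ne_zero {κ : ℝ} (hκ : 0 < κ) {h : E3} (hh : h ≠ 0) (ξ : E3) :
    fderiv ℝ (fun η => freq κ (η + h) - freq κ η) ξ h ≠ 0 := by
  have hd := (contDiff_freq hκ).differentiable (by simp)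
  have hd' : DifferentiableAt ℝ (fun η => freq κ (η + h)) ξ :=
    hd.comp (differentiable_id.add_const h) ξ
  rw [fderiv_fun_sub hd' (hd ξ), fderiv_comp_add_right, sub_apply,
    fderiv_freq hκ, fderiv_freq hκ]
  set A := freq κ (ξ + h)
  set B := freq κ ξ
  have hA : 0 < A := freq_pos hκ _
  have hB : 0 < B := freq_pos hκ _
  have hA2 : A ^ 2 = κ ^ 2 + (‖ξ‖ ^ 2 + 2 * inner ℝ ξ h + ‖h‖ ^ 2) := by
    rw [← norm_add_sq_real]; exact freq_sq κ _
  have hB2 : B ^ 2 = κ ^ 2 + ‖ξ‖ ^ 2 := freq_sq κ _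
  have hin : inner ℝ (ξ + h) h = inner ℝ ξ h + ‖h‖ ^ 2 := by
    rw [inner_add_left, real_inner_self_eq_norm_sq]
  have hcs : (inner ℝ ξ h) ^ 2 ≤ ‖ξ‖ ^ 2 * ‖h‖ ^ 2 := by
    have := abs_real_inner_le_norm ξ h
    rw [← mul_pow, ← sq_abs]
    gcongr
  have hn : 0 < ‖h‖ ^ 2 := by positivity
  rw [hin]
  set c : ℝ := inner ℝ ξ h
  set n : ℝ := ‖h‖ ^ 2
  set q : ℝ := ‖ξ‖ ^ 2
  have hlt : B ^ 2 + c < A * B := by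
    apply lt_of_pow_lt_pow_left₀ 2 (by positivity)
    have hk : 0 < κ ^ 2 * n := by positivity
    rw [mul_pow, hA2]
    nlinarith
  apply ne_of_gt
  have hAB : A ^ 2 = B ^ 2 + 2 * c + n := by rw [hA2, hB2]; ring
  have h1 : (c + n) / A - c / B = (A + B) * (A * B - (B ^ 2 + c)) / (A * B) := by
    have hn' : n = A ^ 2 - B ^ 2 - 2 * c := by linarith
    rw [hn']
    field_simp
    ring
  rw [h1]
  have : 0 < A * B - (B ^ 2 + c) := by linarith
  positivity

/-- The oscillatory integral with amplitude `f` and phase `σ t ω(ξ) + ⟨x, ξ⟩`. -/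
def osc (σ κ : ℝ) (f : E3 → ℂ) (p : ℝ × E3) : ℂ :=
  ∫ ξ, chr (p.1 * (σ * freq κ ξ) + inner ℝ p.2 ξ) * f ξ

lemma integrable_shear_mul_conj {f : E3 → ℂ} (hf : Integrable f) :
    Integrable (fun z : E3 × E3 => f (z.1 + z.2) * conj (f z.1)) (volume.prod volume) := by
  have hc : Integrable fun η => conj (f η) :=
    (Complex.conjCLE : ℂ →L[ℝ] ℂ).integrable_comp hf
  refine ((measurePreserving_prod_add (volume : Measure E3) volume).integrable_comp_of_integrable
    (hc.mul_prod hf)).congr (Eventually.of_forall fun z => ?_)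
  simp [mul_comm]

lemma continuous_phase {κ : ℝ} (hκ : 0 < κ) (σ t : ℝ) (x : E3) :
    Continuous fun ξ : E3 => chr (t * (σ * freq κ ξ) + inner ℝ x ξ) :=
  contDiff_chr.continuous.comp
    ((continuous_const.mul (continuous_const.mul (contDiff_freq hκ).continuous)).add
      (continuous_const.inner continuous_id))

lemma integrable_phase_mul {κ : ℝ} (hκ : 0 < κ) (σ t : ℝ) (x : E3) {f : E3 → ℂ}
    (hf : Integrable f) :
    Integrable fun ξ => chr (t * (σ * freq κ ξ) + inner ℝ x ξ) * f ξ := by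
  refine hf.norm.mono' ((continuous_phase hκ σ t x).aestronglyMeasurable.mul hf.1)
    (Eventually.of_forall fun ξ => ?_)
  simp

lemma norm_osc_sq_le {σ κ : ℝ} (hκ : 0 < κ) {f : E3 → ℂ} (hf : Integrable f)
    (t : ℝ) (x : E3) :
    ‖osc σ κ f (t, x)‖ ^ 2 ≤ ∫ h, ‖∫ η, chr (t * (σ * (freq κ (η + h) - freq κ η))) *
      (f (η + h) * conj (f η))‖ := by
  set a : E3 → ℂ := fun ξ => chr (t * (σ * freq κ ξ) + inner ℝ x ξ) * f ξ with ha
  have hai : Integrable a := integrable_phase_mul hκ σ t x hf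
  have hprod := integrable_shear_mul_conj hai
  have hkey : (∫ ξ, a ξ) * conj (∫ ξ, a ξ) = ∫ h, ∫ η, a (η + h) * conj (a η) := by
    rw [← integral_integral_swap hprod, ← integral_conj, ← integral_const_mul]
    congr 1
    funext η
    rw [integral_mul_const, integral_add_left_eq_self]
  have hsq : ‖osc σ κ f (t, x)‖ ^ 2 = ‖(∫ ξ, a ξ) * conj (∫ ξ, a ξ)‖ := by
    rw [norm_mul, RCLike.norm_conj, sq]
    rfl
  rw [hsq, hkey]
  refine (norm_integral_le_integral_norm _).trans (le_of_eq ?_)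
  congr 1
  funext h
  have : ∀ η, a (η + h) * conj (a η) = chr (inner ℝ x h) *
      (chr (t * (σ * (freq κ (η + h) - freq κ η))) * (f (η + h) * conj (f η))) := by
    intro η
    have hph : chr (t * (σ * freq κ (η + h)) + inner ℝ x (η + h)) *
        chr (-(t * (σ * freq κ η) + inner ℝ x η)) = chr (inner ℝ x h) *
        chr (t * (σ * (freq κ (η + h) - freq κ η))) := by
      rw [← chr_add, ← chr_add, inner_add_right]
      congr 1
      ring
    rw [← mul_assoc (chr _), ← hph, ha]
    simp only [map_mul, conj_chr]
    ring
  simp_rw [this, integral_const_mul]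
  simp

lemma osc_decay_of_contDiff {σ κ : ℝ} (hσ : σ ≠ 0) (hκ : 0 < κ) {f : E3 → ℂ}
    (hf : ContDiff ℝ ∞ f) (hfc : HasCompactSupport f) {ε : ℝ} (hε : 0 < ε) :
    ∀ᶠ t : ℝ in atTop, ∀ x, ‖osc σ κ f (t, x)‖ ≤ ε := by
  have hfi : Integrable f := hf.continuous.integrable_of_hasCompactSupport hfc
  have hprod := integrable_shear_mul_conj hfi
  have hbd : Integrable fun h => ∫ η, ‖f (η + h) * conj (f η)‖ := hprod.norm.integral_prod_right
  have hlim : Tendsto (fun t : ℝ => ∫ h, ‖∫ η, chr (t * (σ * (freq κ (η + h) - freq κ η))) *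
      (f (η + h) * conj (f η))‖) atTop (𝓝 (∫ h : E3, (0 : ℝ))) := by
    refine tendsto_integral_filter_of_dominated_convergence _ (Eventually.of_forall fun t => ?_)
      (Eventually.of_forall fun t => Eventually.of_forall fun h => ?_) hbd ?_
    · have hph : Continuous fun z : E3 × E3 =>
          chr (t * (σ * (freq κ (z.1 + z.2) - freq κ z.1))) := by
        have := (contDiff_freq hκ).continuous
        have := contDiff_chr.continuous
        fun_prop
      have : Integrable (fun z : E3 × E3 => chr (t * (σ * (freq κ (z.1 + z.2) - freq κ z.1))) *
          (f (z.1 + z.2) * conj (f z.1))) (volume.prod volume) := by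
        refine hprod.norm.mono' (hph.aestronglyMeasurable.mul hprod.1)
          (Eventually.of_forall fun z => ?_)
        simp
      exact this.integral_prod_right.norm.1
    · rw [norm_norm]
      refine (norm_integral_le_integral_norm _).trans (le_of_eq ?_)
      simp
    · have h0 : ∀ᵐ h : E3, h ≠ 0 := by
        simp [ae_iff]
      filter_upwards [h0] with h hh
      rw [← norm_zero (E := ℂ)]
      refine Tendsto.norm ?_
      have hfr := contDiff_freq hκ
      have hsub : ContDiff ℝ ∞ fun η : E3 => freq κ (η + h) - freq κ η :=
        (hfr.comp (contDiff_id.add contDiff_const)).sub hfr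
      refine tendsto_integral_chr_mul (h := h) (contDiff_const.mul hsub) (fun ξ => ?_)
        ((hf.comp (contDiff_id.add contDiff_const)).mul
          (Complex.conjCLE.contDiff.comp hf)) ?_
      · rw [fderiv_const_mul (hsub.differentiable (by simp) ξ)]
        simpa [hσ] using fderiv_freq_sub_ne_zero hκ hh ξ
      · exact (hfc.comp_left (g := fun z : ℂ => conj z) (by simp)).mul_left
  rw [integral_zero] at hlim
  filter_upwards [hlim.eventually (ge_mem_nhds (by positivity : 0 < ε ^ 2))] with t ht x
  exact (sq_le_sq₀ (norm_nonneg _) hε.le).1 ((norm_osc_sq_le hκ hfi t x).trans ht)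

/-- Oscillatory integrals with integrable amplitude decay uniformly in space. -/
lemma osc_decay {σ κ : ℝ} (hσ : σ ≠ 0) (hκ : 0 < κ) {f : E3 → ℂ} (hf : Integrable f)
    {ε : ℝ} (hε : 0 < ε) : ∀ᶠ t : ℝ in atTop, ∀ x, ‖osc σ κ f (t, x)‖ ≤ ε := by
  obtain ⟨g, hgc, hgs, hg⟩ := MemLp.exist_eLpNorm_sub_le (p := 1) (by simp) le_rfl
    (memLp_one_iff_integrable.2 hf) (half_pos hε)
  have hgi : Integrable g := hgs.continuous.integrable_of_hasCompactSupport hgc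
  have hfg : ∫ ξ, ‖f ξ - g ξ‖ ≤ ε / 2 := by
    change ∫ ξ, ‖(f - g) ξ‖ ≤ ε / 2
    rw [integral_norm_eq_lintegral_enorm (hf.sub hgi).1]
    refine ENNReal.toReal_le_of_le_ofReal (by positivity) ?_
    simpa [eLpNorm_one_eq_lintegral_enorm] using hg
  filter_upwards [osc_decay_of_contDiff hσ hκ hgs hgc (half_pos hε)] with t ht x
  have hsplit : osc σ κ f (t, x) = osc σ κ g (t, x) + osc σ κ (fun ξ => f ξ - g ξ) (t, x) := by
    simp only [osc]
    rw [← sub_eq_iff_eq_add', ← integral_sub (integrable_phase_mul hκ σ t x hf)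
      (integrable_phase_mul hκ σ t x hgi)]
    simp only [mul_sub]
  have h2 : ‖osc σ κ (fun ξ => f ξ - g ξ) (t, x)‖ ≤ ε / 2 := by
    refine (norm_integral_le_integral_norm _).trans (le_trans (le_of_eq ?_) hfg)
    simp
  rw [hsplit]
  exact (norm_add_le _ _).trans (by linarith [ht x])

end OscillatoryIntegrals

section FreeWaves

open scoped ContDiff FourierTransform

/-- Continuous functions which are integrable against all polynomial weights. -/
def RapidDecay (f : E3 → ℂ) : Prop :=
  Continuous f ∧ ∀ n : ℕ, Integrable fun ξ => (1 + ‖ξ‖) ^ n * ‖f ξ‖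

lemma RapidDecay.integrable {f : E3 → ℂ} (hf : RapidDecay f) : Integrable f := by
  have := hf.2 0
  simp only [pow_zero, one_mul] at this
  exact (integrable_norm_iff hf.1.aestronglyMeasurable).1 this

lemma RapidDecay.mul {f : E3 → ℂ} (hf : RapidDecay f) {s : E3 → ℂ} (hs : Continuous s)
    {C : ℝ} (hC : ∀ ξ, ‖s ξ‖ ≤ C * (1 + ‖ξ‖)) : RapidDecay fun ξ => s ξ * f ξ := by
  refine ⟨hs.mul hf.1, fun n => ((hf.2 (n + 1)).const_mul C).mono' ?_ ?_⟩
  · exact (((continuous_const.add continuous_norm).pow n).mul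
      (hs.mul hf.1).norm).aestronglyMeasurable
  · refine Eventually.of_forall fun ξ => ?_
    rw [Real.norm_of_nonneg (by positivity), norm_mul]
    calc (1 + ‖ξ‖) ^ n * (‖s ξ‖ * ‖f ξ‖)
        ≤ (1 + ‖ξ‖) ^ n * (C * (1 + ‖ξ‖) * ‖f ξ‖) := by gcongr; exact hC ξ
      _ = _ := by ring

lemma RapidDecay.add {f g : E3 → ℂ} (hf : RapidDecay f) (hg : RapidDecay g) :
    RapidDecay fun ξ => f ξ + g ξ := by
  refine ⟨hf.1.add hg.1, fun n => ((hf.2 n).add (hg.2 n)).mono' ?_ ?_⟩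
  · exact (((continuous_const.add continuous_norm).pow n).mul
      (hf.1.add hg.1).norm).aestronglyMeasurable
  · refine Eventually.of_forall fun ξ => ?_
    rw [Real.norm_of_nonneg (by positivity), Pi.add_apply, ← mul_add]
    gcongr
    exact norm_add_le _ _

lemma SchwartzMap.rapidDecay (g : SchwartzMap E3 ℂ) : RapidDecay g := by
  refine ⟨g.continuous, fun n => ?_⟩
  have h := ((g.integrable_pow_mul volume 0).add (g.integrable_pow_mul volume n)).const_mul
    ((2 : ℝ) ^ (n - 1))
  refine h.mono' (((continuous_const.add continuous_norm).pow n).mul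
    g.continuous.norm).aestronglyMeasurable (Eventually.of_forall fun ξ => ?_)
  rw [Real.norm_of_nonneg (by positivity)]
  have := add_pow_le (zero_le_one (α := ℝ)) (norm_nonneg ξ) n
  calc (1 + ‖ξ‖) ^ n * ‖g ξ‖ ≤ (2 ^ (n - 1) * (1 ^ n + ‖ξ‖ ^ n)) * ‖g ξ‖ := by gcongr
    _ = _ := by simp; ring

lemma freq_le {κ : ℝ} (hκ : 0 < κ) (ξ : E3) : freq κ ξ ≤ (1 + κ) * (1 + ‖ξ‖) := by
  apply Real.sqrt_le_iff.2
  have := norm_nonneg ξ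
  constructor
  · positivity
  · nlinarith [mul_nonneg hκ.le this, sq_nonneg κ, mul_nonneg (sq_nonneg κ) this,
      mul_nonneg (sq_nonneg κ) (sq_nonneg ‖ξ‖), mul_nonneg hκ.le (sq_nonneg ‖ξ‖)]

/-- The Euclidean pairing `⟨(a, x), (b, y)⟩ = a b + ⟨x, y⟩` on space-time. -/
def pairing : (ℝ × E3) →L[ℝ] (ℝ × E3) →L[ℝ] ℝ :=
  let B : E3 →L[ℝ] E3 →L[ℝ] ℝ := innerSL ℝ
  (ContinuousLinearMap.mul ℝ ℝ).bilinearComp (ContinuousLinearMap.fst ℝ ℝ E3)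
      (ContinuousLinearMap.fst ℝ ℝ E3) +
    B.bilinearComp (ContinuousLinearMap.snd ℝ ℝ E3) (ContinuousLinearMap.snd ℝ ℝ E3)

lemma pairing_apply (v w : ℝ × E3) : pairing v w = v.1 * w.1 + inner ℝ v.2 w.2 := rfl

/-- Minus the parametrization of the mass hyperboloid. -/
def shell (σ κ : ℝ) (ξ : E3) : ℝ × E3 := (-(σ * freq κ ξ), -ξ)

lemma continuous_shell {κ : ℝ} (hκ : 0 < κ) (σ : ℝ) : Continuous (shell σ κ) :=
  ((continuous_const.mul (contDiff_freq hκ).continuous).neg).prodMk continuous_neg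

lemma measurableEmbedding_shell {κ : ℝ} (hκ : 0 < κ) (σ : ℝ) :
    MeasurableEmbedding (shell σ κ) :=
  (continuous_shell hκ σ).measurableEmbedding fun _ _ h => neg_injective (congrArg Prod.snd h)

lemma norm_shell_le {κ : ℝ} (hκ : 0 < κ) (σ : ℝ) (ξ : E3) :
    ‖shell σ κ ξ‖ ≤ (1 + |σ| * (1 + κ)) * (1 + ‖ξ‖) := by
  have h0 := norm_nonneg ξ
  have h1 := mul_le_mul_of_nonneg_left (freq_le hκ ξ) (abs_nonneg σ)
  have h2 : 0 ≤ |σ| * (1 + κ) * (1 + ‖ξ‖) := by positivity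
  refine max_le ?_ ?_
  · simp only [shell, norm_neg, norm_mul, Real.norm_eq_abs]
    rw [abs_of_pos (freq_pos hκ ξ)]
    nlinarith
  · simp only [shell, norm_neg]
    nlinarith

lemma osc_eq_fourierIntegral {κ : ℝ} (hκ : 0 < κ) (σ : ℝ) (f : E3 → ℂ) :
    osc σ κ f = VectorFourier.fourierIntegral Real.fourierChar (volume.map (shell σ κ))
      pairing.toLinearMap₁₂ (fun v => f (-v.2)) := by
  funext p
  rw [VectorFourier.fourierIntegral, (measurableEmbedding_shell hκ σ).integral_map]
  refine integral_congr_ae (Eventually.of_forall fun ξ => ?_)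
  simp only [shell, neg_neg, ContinuousLinearMap.toLinearMap₁₂_apply_apply_apply, pairing_apply,
    Circle.smul_def, chr, smul_eq_mul, inner_neg_left, real_inner_comm]
  congr 3
  ring

variable {κ : ℝ} {f g : E3 → ℂ}

lemma RapidDecay.integrable_shell (hκ : 0 < κ) (hf : RapidDecay f) (σ : ℝ) (n : ℕ) :
    Integrable (fun v : ℝ × E3 => ‖v‖ ^ n * ‖f (-v.2)‖) (volume.map (shell σ κ)) := by
  rw [(measurableEmbedding_shell hκ σ).integrable_map_iff]
  refine ((hf.2 n).const_mul ((1 + |σ| * (1 + κ)) ^ n)).mono' ?_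
    (Eventually.of_forall fun ξ => ?_)
  · refine Continuous.aestronglyMeasurable ?_
    have := continuous_shell hκ σ
    have := hf.1
    simp only [Function.comp_def]
    fun_prop
  · simp only [Function.comp_def]
    rw [Real.norm_of_nonneg (by positivity), ← mul_assoc, ← mul_pow]
    have : f (-(shell σ κ ξ).2) = f ξ := by simp [shell]
    rw [this]
    gcongr
    exact norm_shell_le hκ σ ξ

lemma contDiff_osc (hκ : 0 < κ) (hf : RapidDecay f) (σ : ℝ) : ContDiff ℝ ∞ (osc σ κ f) := by
  rw [osc_eq_fourierIntegral hκ]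
  exact VectorFourier.contDiff_fourierIntegral _ fun n _ => hf.integrable_shell hκ σ n

lemma fderiv_osc (hκ : 0 < κ) (hf : RapidDecay f) (σ : ℝ) (p v : ℝ × E3) :
    fderiv ℝ (osc σ κ f) p v = osc σ κ (fun ξ =>
      2 * Real.pi * Complex.I * ((v.1 * (σ * freq κ ξ) + inner ℝ v.2 ξ : ℝ) : ℂ) * f ξ) p := by
  have h0 : Integrable (fun v : ℝ × E3 => f (-v.2)) (volume.map (shell σ κ)) := by
    rw [(measurableEmbedding_shell hκ σ).integrable_map_iff]
    simpa [Function.comp_def, shell] using hf.integrable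
  have h1 : Integrable (fun v : ℝ × E3 => ‖v‖ * ‖f (-v.2)‖) (volume.map (shell σ κ)) := by
    simpa using hf.integrable_shell hκ σ 1
  have hd := VectorFourier.hasFDerivAt_fourierIntegral pairing h0 h1 p
  rw [osc_eq_fourierIntegral hκ, hd.fderiv,
    Real.fourierIntegral_continuousLinearMap_apply', osc_eq_fourierIntegral hκ]
  · rw [VectorFourier.fourierIntegral, VectorFourier.fourierIntegral,
      (measurableEmbedding_shell hκ σ).integral_map, (measurableEmbedding_shell hκ σ).integral_map]
    refine integral_congr_ae (Eventually.of_forall fun ξ => ?_)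
    simp only [VectorFourier.fourierSMulRight_apply, shell, neg_neg, pairing_apply]
    congr 1
    simp only [inner_neg_left, real_inner_comm, smul_eq_mul, Complex.real_smul]
    push_cast
    ring
  · refine (h1.const_mul (2 * Real.pi * ‖pairing‖)).mono'
      h0.1.fourierSMulRight (Eventually.of_forall fun v => ?_)
    exact (VectorFourier.norm_fourierSMulRight_le _ _ _).trans (le_of_eq (by ring))

lemma osc_add (hκ : 0 < κ) (hf : RapidDecay f) (hg : RapidDecay g) (σ : ℝ) (p : ℝ × E3) :
    osc σ κ (fun ξ => f ξ + g ξ) p = osc σ κ f p + osc σ κ g p := by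
  simp only [osc, mul_add]
  exact integral_add (integrable_phase_mul hκ σ p.1 p.2 hf.integrable)
    (integrable_phase_mul hκ σ p.1 p.2 hg.integrable)

lemma osc_const_mul (σ : ℝ) (c : ℂ) (p : ℝ × E3) :
    osc σ κ (fun ξ => c * f ξ) p = c * osc σ κ f p := by
  simp only [osc, ← integral_const_mul]
  congr 1
  funext ξ
  ring

/-- The real part of an oscillatory integral. -/
def reOsc (σ κ : ℝ) (f : E3 → ℂ) : ℝ × E3 → ℝ := fun p => (osc σ κ f p).re

lemma smooth_reOsc (hκ : 0 < κ) (hf : RapidDecay f) (σ : ℝ) : Smooth (reOsc σ κ f) :=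
  Complex.reCLM.contDiff.comp (contDiff_osc hκ hf σ)

lemma pd_reOsc (hκ : 0 < κ) (hf : RapidDecay f) (σ : ℝ) (v : ℝ × E3) :
    pd v (reOsc σ κ f) = reOsc σ κ (fun ξ =>
      2 * Real.pi * Complex.I * ((v.1 * (σ * freq κ ξ) + inner ℝ v.2 ξ : ℝ) : ℂ) * f ξ) := by
  funext p
  have h1 : HasFDerivAt (reOsc σ κ f) (Complex.reCLM.comp (fderiv ℝ (osc σ κ f) p)) p :=
    Complex.reCLM.hasFDerivAt.comp p
      ((contDiff_osc hκ hf σ).differentiable (by simp) p).hasFDerivAt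
  rw [pd, h1.fderiv]
  change (fderiv ℝ (osc σ κ f) p v).re = _
  rw [fderiv_osc hκ hf]
  rfl

lemma RapidDecay.freq_mul (hκ : 0 < κ) (hf : RapidDecay f) (c : ℂ) :
    RapidDecay fun ξ => c * freq κ ξ * f ξ := by
  refine hf.mul (C := ‖c‖ * (1 + κ)) ?_ fun ξ => ?_
  · have := (contDiff_freq hκ).continuous
    fun_prop
  · rw [norm_mul, Complex.norm_real, Real.norm_of_nonneg (freq_pos hκ ξ).le, mul_assoc]
    gcongr
    exact freq_le hκ ξ

lemma RapidDecay.coord_mul (hf : RapidDecay f) (c : ℂ) (j : Fin 3) :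
    RapidDecay fun ξ => c * ξ j * f ξ := by
  refine hf.mul (C := ‖c‖) (by fun_prop) fun ξ => ?_
  rw [norm_mul, Complex.norm_real]
  gcongr
  have := PiLp.norm_apply_le ξ j
  linarith

lemma pd_e0_reOsc (hκ : 0 < κ) (hf : RapidDecay f) (σ : ℝ) :
    pd e0 (reOsc σ κ f)
      = reOsc σ κ (fun ξ => (2 * Real.pi * Complex.I * σ) * freq κ ξ * f ξ) := by
  rw [pd_reOsc hκ hf]
  congr 1
  funext ξ
  simp only [e0, inner_zero_left, one_mul, add_zero]
  push_cast
  ring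

lemma pd_ej_reOsc (hκ : 0 < κ) (hf : RapidDecay f) (σ : ℝ) (j : Fin 3) :
    pd (ej j) (reOsc σ κ f)
      = reOsc σ κ (fun ξ => (2 * Real.pi * Complex.I) * ξ j * f ξ) := by
  rw [pd_reOsc hκ hf]
  congr 1
  funext ξ
  simp [ej, EuclideanSpace.inner_single_left]

/-- Superpositions of plane waves on the mass shell solve the free equation. -/
lemma smoothSol_reOsc {m : ℝ} (hm : 0 < m) (hf : RapidDecay f) {σ : ℝ} (hσ : σ ^ 2 = 1) :
    SmoothSol m 0 (reOsc σ (m / (2 * Real.pi)) f) := by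
  set κ := m / (2 * Real.pi) with hκdef
  have hκ : 0 < κ := by positivity
  refine ⟨smooth_reOsc hκ hf σ, fun p => ?_⟩
  rw [pd_e0_reOsc hκ hf, pd_e0_reOsc hκ (hf.freq_mul hκ _)]
  simp_rw [pd_ej_reOsc hκ hf, fun j => pd_ej_reOsc hκ (hf.coord_mul (2 * Real.pi * Complex.I) j) σ j]
  simp only [derivative_zero, eval_zero, add_zero, reOsc]
  have hi := fun (F : E3 → ℂ) (hF : RapidDecay F) =>
    integrable_phase_mul hκ σ p.1 p.2 hF.integrable
  rw [← Complex.re_sum, ← Complex.sub_re]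
  have hmre : m ^ 2 * (osc σ κ f p).re = (((m ^ 2 : ℝ) : ℂ) * osc σ κ f p).re := by
    rw [Complex.re_ofReal_mul]
  rw [hmre, ← Complex.add_re]
  simp only [osc]
  rw [← integral_finsetSum _ fun j _ => hi _ ((hf.coord_mul _ j).coord_mul _ j),
    ← integral_sub (hi _ ((hf.freq_mul hκ _).freq_mul hκ _))
      (integrable_finsetSum _ fun j _ => hi _ ((hf.coord_mul _ j).coord_mul _ j)),
    ← integral_const_mul, ← integral_add]
  · rw [integral_eq_zero_of_ae, Complex.zero_re]
    refine Eventually.of_forall fun ξ => ?_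
    have hfreq : (freq κ ξ : ℂ) ^ 2 = κ ^ 2 + ∑ j, (ξ j : ℂ) ^ 2 := by
      have := freq_sq κ ξ
      rw [EuclideanSpace.real_norm_sq_eq] at this
      exact_mod_cast this
    have hmκ : (m : ℂ) = 2 * Real.pi * κ := by
      have : m = 2 * Real.pi * κ := by rw [hκdef]; field_simp
      exact_mod_cast this
    have hσ' : (σ : ℂ) ^ 2 = 1 := by exact_mod_cast hσ
    simp only [Fin.sum_univ_three, Pi.zero_apply] at hfreq ⊢
    push_cast
    rw [hmκ]
    generalize chr _ = c
    have hI := Complex.I_sq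
    linear_combination (c * f ξ * (2 * Real.pi) ^ 2 * Complex.I ^ 2 * (freq κ ξ : ℂ) ^ 2) * hσ'
      + (c * f ξ * (2 * Real.pi) ^ 2 * Complex.I ^ 2) * hfreq
      + (c * f ξ * (2 * Real.pi) ^ 2 * κ ^ 2) * hI
  · exact (hi _ ((hf.freq_mul hκ _).freq_mul hκ _)).sub
      (integrable_finsetSum _ fun j _ => hi _ ((hf.coord_mul _ j).coord_mul _ j))
  · exact (hi _ hf).const_mul _

lemma SmoothSol.add_free {m : ℝ} {Φ Ψ : ℝ × E3 → ℝ} (h : SmoothSol m 0 Φ)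
    (h' : SmoothSol m 0 Ψ) : SmoothSol m 0 fun p => Φ p + Ψ p := by
  refine ⟨h.1.add h'.1, fun p => ?_⟩
  have e := fun v => funext fun q => pd_add (v := v) h.1 h'.1 q
  rw [e]
  simp_rw [e]
  rw [pd_add h.1.dir h'.1.dir]
  simp_rw [fun j => pd_add (v := ej j) (h.1.dir (v := ej j)) (h'.1.dir (v := ej j)) p,
    Finset.sum_add_distrib]
  have h1 := h.2 p
  have h2 := h'.2 p
  simp only [derivative_zero, eval_zero] at h1 h2 ⊢
  linarith

lemma SmoothSol.sub_free {m : ℝ} {Φ Ψ : ℝ × E3 → ℝ} (h : SmoothSol m 0 Φ)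
    (h' : SmoothSol m 0 Ψ) : SmoothSol m 0 fun p => Φ p - Ψ p := by
  refine ⟨h.1.sub h'.1, fun p => ?_⟩
  have e := fun v => funext fun q => pd_sub (v := v) h.1 h'.1 q
  rw [e]
  simp_rw [e]
  rw [pd_sub h.1.dir h'.1.dir]
  simp_rw [fun j => pd_sub (v := ej j) (h.1.dir (v := ej j)) (h'.1.dir (v := ej j)) p,
    Finset.sum_sub_distrib]
  have h1 := h.2 p
  have h2 := h'.2 p
  simp only [derivative_zero, eval_zero] at h1 h2 ⊢
  linarith

/-- The oscillatory integral at time `0` inverts the Fourier transform. -/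
lemma osc_zero_fourier (σ : ℝ) (φ : SchwartzMap E3 ℂ) (x : E3) :
    osc σ κ (𝓕 φ : SchwartzMap E3 ℂ) (0, x) = φ x := by
  have h : (𝓕⁻ (𝓕 φ : SchwartzMap E3 ℂ) : SchwartzMap E3 ℂ) x = φ x := by
    rw [FourierTransform.fourierInv_fourier_eq]
  rw [← h, SchwartzMap.fourierInv_coe, Real.fourierInv_eq]
  simp only [osc, chr, zero_mul, zero_add, Circle.smul_def, smul_eq_mul, real_inner_comm]

/-- Free solutions are superpositions of plane waves on the mass shell. -/
lemma SmoothSol.exists_reOsc {m : ℝ} (hm : 0 < m) {Ψ : ℝ × E3 → ℝ} (h : SmoothSol m 0 Ψ)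
    (hd : SchwartzData Ψ) :
    ∃ f g : E3 → ℂ, RapidDecay f ∧ RapidDecay g ∧ ∀ t : ℝ, 0 ≤ t → ∀ x : E3,
      Ψ (t, x) = reOsc 1 (m / (2 * Real.pi)) f (t, x)
        + reOsc (-1) (m / (2 * Real.pi)) g (t, x) := by
  set κ := m / (2 * Real.pi) with hκdef
  have hκ : 0 < κ := by positivity
  obtain ⟨⟨φ, hφ⟩, ⟨π, hπ⟩⟩ := hd 0
  set φc : SchwartzMap E3 ℂ := 𝓕 (SchwartzMap.postcompCLM (𝕜 := ℝ) Complex.ofRealCLM φ)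
  set πc : SchwartzMap E3 ℂ := 𝓕 (SchwartzMap.postcompCLM (𝕜 := ℝ) Complex.ofRealCLM π)
  have hφc : ∀ (σ : ℝ) (x : E3), reOsc σ κ φc (0, x) = φ x := by
    intro σ x
    rw [reOsc, osc_zero_fourier]
    simp
  have hπc : ∀ (σ : ℝ) (x : E3), reOsc σ κ πc (0, x) = π x := by
    intro σ x
    rw [reOsc, osc_zero_fourier]
    simp
  set q : E3 → ℂ := fun ξ => (2 * Real.pi * Complex.I * freq κ ξ)⁻¹ * πc ξ with hq
  have hfne : ∀ ξ, (freq κ ξ : ℂ) ≠ 0 := fun ξ => by exact_mod_cast (freq_pos hκ ξ).ne'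
  have hpi : (Real.pi : ℂ) ≠ 0 := by exact_mod_cast Real.pi_ne_zero
  have hqr : RapidDecay q := by
    refine (SchwartzMap.rapidDecay πc).mul (C := (2 * Real.pi * κ)⁻¹) ?_ fun ξ => ?_
    · have := (contDiff_freq hκ).continuous
      refine Continuous.inv₀ (by fun_prop) fun ξ => ?_
      simp [hfne, hpi]
    · have h1 : κ ≤ freq κ ξ := Real.le_sqrt_of_sq_le (by nlinarith [sq_nonneg ‖ξ‖])
      have h2 : ‖(2 * Real.pi * Complex.I * freq κ ξ)⁻¹‖ ≤ (2 * Real.pi * κ)⁻¹ := by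
        rw [norm_inv]
        gcongr
        simp only [norm_mul, Complex.norm_real, Complex.norm_I, Complex.norm_two, mul_one,
          Real.norm_of_nonneg Real.pi_pos.le, Real.norm_of_nonneg (freq_pos hκ ξ).le]
        gcongr
      refine h2.trans (le_mul_of_one_le_right (by positivity) ?_)
      linarith [norm_nonneg ξ]
  have half : ∀ {F : E3 → ℂ} (c : ℂ), RapidDecay F → RapidDecay fun ξ => c * F ξ := by
    intro F c hF
    refine hF.mul (C := ‖c‖) continuous_const fun ξ => ?_
    exact le_mul_of_one_le_right (norm_nonneg _) (by linarith [norm_nonneg ξ])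
  have hφr := SchwartzMap.rapidDecay φc
  set f : E3 → ℂ := fun ξ => (1 / 2 : ℝ) * φc ξ + (1 / 2 : ℝ) * q ξ
  set g : E3 → ℂ := fun ξ => (1 / 2 : ℝ) * φc ξ + (-1 / 2 : ℝ) * q ξ
  have hf : RapidDecay f := (half _ hφr).add (half _ hqr)
  have hg : RapidDecay g := (half _ hφr).add (half _ hqr)
  refine ⟨f, g, hf, hg, fun t ht x => ?_⟩
  have hu := (smoothSol_reOsc hm hf (σ := 1) (by norm_num)).add_free
    (smoothSol_reOsc hm hg (σ := -1) (by norm_num))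
  rw [← hκdef] at hu
  have hlin : ∀ (σ a b : ℝ) (F G : E3 → ℂ) (p : ℝ × E3), RapidDecay F → RapidDecay G →
      reOsc σ κ (fun ξ => a * F ξ + b * G ξ) p = a * reOsc σ κ F p + b * reOsc σ κ G p := by
    intro σ a b F G p hF hG
    simp only [reOsc]
    rw [osc_add hκ (half _ hF) (half _ hG), osc_const_mul, osc_const_mul, Complex.add_re,
      Complex.re_ofReal_mul, Complex.re_ofReal_mul]
  have hz0 : ∀ (σ : ℝ) (F : E3 → ℂ) (x : E3), reOsc σ κ F (0, x) = reOsc 1 κ F (0, x) := by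
    intro σ F x
    simp [reOsc, osc]
  have key := (h.sub_free hu).eq_zero_of_data hm (fun x => ?_) (fun x => ?_) ht x
  · linarith
  · rw [hlin _ _ _ _ _ _ hφr hqr, hlin _ _ _ _ _ _ hφr hqr, hφc, hφc, ← hφ x, hz0 (-1)]
    ring
  · rw [pd_sub h.1 hu.1, pd_add (smooth_reOsc hκ hf 1) (smooth_reOsc hκ hg (-1)), ← hπ x,
      pd_e0_reOsc hκ hf, pd_e0_reOsc hκ hg]
    have e1 : (fun ξ => (2 * Real.pi * Complex.I * (1 : ℝ)) * freq κ ξ * f ξ)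
        = fun ξ => (1 / 2 : ℝ) * ((2 * Real.pi * Complex.I) * freq κ ξ * φc ξ)
          + (1 / 2 : ℝ) * πc ξ := by
      funext ξ
      have := hfne ξ
      simp only [f, hq]
      field_simp
      push_cast
      ring
    have e2 : (fun ξ => (2 * Real.pi * Complex.I * (-1 : ℝ)) * freq κ ξ * g ξ)
        = fun ξ => (-1 / 2 : ℝ) * ((2 * Real.pi * Complex.I) * freq κ ξ * φc ξ)
          + (1 / 2 : ℝ) * πc ξ := by
      funext ξ
      have := hfne ξ
      simp only [g, hq]
      field_simp
      push_cast
      ring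
    have hπr := SchwartzMap.rapidDecay πc
    rw [e1, e2, hlin _ _ _ _ _ _ (hφr.freq_mul hκ _) hπr,
      hlin _ _ _ _ _ _ (hφr.freq_mul hκ _) hπr, hπc, hπc, hz0 (-1)]
    ring

/-- Free solutions with Schwartz data decay uniformly in space. -/
lemma SmoothSol.free_decay {m : ℝ} (hm : 0 < m) {Ψ : ℝ × E3 → ℝ} (h : SmoothSol m 0 Ψ)
    (hd : SchwartzData Ψ) {δ : ℝ} (hδ : 0 < δ) :
    ∀ᶠ t : ℝ in atTop, ∀ x, |Ψ (t, x)| ≤ δ := by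
  obtain ⟨f, g, hf, hg, hΨ⟩ := h.exists_reOsc hm hd
  have hκ : 0 < m / (2 * Real.pi) := by positivity
  filter_upwards [eventually_ge_atTop 0,
    osc_decay (σ := 1) one_ne_zero hκ hf.integrable (half_pos hδ),
    osc_decay (σ := -1) (by norm_num) hκ hg.integrable (half_pos hδ)] with t ht h1 h2 x
  rw [hΨ t ht x]
  have a1 := (Complex.abs_re_le_norm _).trans (h1 x)
  have a2 := (Complex.abs_re_le_norm _).trans (h2 x)
  exact (abs_add_le _ _).trans (by simp only [reOsc]; linarith)

end FreeWaves

section PolynomialBounds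

lemma X_pow_three_dvd {V : Polynomial ℝ} (h0 : V.eval 0 = 0) (h1 : (derivative V).eval 0 = 0)
    (h2 : (derivative (derivative V)).eval 0 = 0) : X ^ 3 ∣ V := by
  rw [X_pow_dvd_iff]
  rw [← coeff_zero_eq_eval_zero] at h0 h1 h2
  simp only [coeff_derivative] at h1 h2
  intro d hd
  interval_cases d
  · exact h0
  · simpa using h1
  · simpa using h2

lemma leadingCoeff_pos_of_nonneg {V : Polynomial ℝ} (hV : ∀ s : ℝ, 0 ≤ V.eval s)
    (h : 0 < V.degree) : 0 < V.leadingCoeff := by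
  by_contra! hl
  obtain ⟨s, hs⟩ := ((tendsto_atBot_of_leadingCoeff_nonpos V h hl).eventually_lt_atBot 0).exists
  exact absurd (hV s) (not_le.2 hs)

/-- One-sided bounds for a nonnegative polynomial with a triple zero at the origin. -/
lemma exists_bounds_of_nonneg {V : Polynomial ℝ} (hV : ∀ s : ℝ, 0 ≤ V.eval s)
    (h3 : X ^ 3 ∣ V) : ∃ K : ℝ, 0 ≤ K ∧ ∀ s : ℝ, 0 ≤ s →
      V.eval s ≤ s * (derivative V).eval s + K * (s ^ 2 * min s 1) ∧
      |(derivative V).eval s| ≤ K * (s ^ 2 + V.eval s) := by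
  rcases eq_or_ne V 0 with rfl | hV0
  · exact ⟨0, le_rfl, by simp⟩
  have hnd : 3 ≤ V.natDegree := by
    have := natDegree_le_of_dvd h3 hV0
    simpa using this
  have hdeg : 0 < V.degree := natDegree_pos_iff_degree_pos.1 (by omega)
  have hl := leadingCoeff_pos_of_nonneg hV hdeg
  set P := V - X * derivative V with hP
  have hPc : P.coeff V.natDegree = (1 - (V.natDegree : ℝ)) * V.leadingCoeff := by
    obtain ⟨n, hn⟩ : ∃ n, V.natDegree = n + 1 := ⟨V.natDegree - 1, by omega⟩
    rw [hP, coeff_sub, leadingCoeff, hn, coeff_X_mul, coeff_derivative]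
    push_cast
    ring
  have hnd' : (3 : ℝ) ≤ V.natDegree := by exact_mod_cast hnd
  have hPneg : P.coeff V.natDegree < 0 := by
    rw [hPc]
    nlinarith
  have hPdeg : P.natDegree = V.natDegree := by
    refine le_antisymm ?_ (le_natDegree_of_ne_zero hPneg.ne)
    refine (natDegree_sub_le _ _).trans (max_le le_rfl ?_)
    refine natDegree_mul_le.trans ?_
    have := natDegree_derivative_le V
    rw [natDegree_X]
    omega
  have hPlim : Tendsto (fun s => P.eval s) atTop atBot := by
    refine tendsto_atBot_of_leadingCoeff_nonpos P
      (natDegree_pos_iff_degree_pos.1 (by omega)) ?_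
    rw [leadingCoeff, hPdeg]
    exact hPneg.le
  have hO := isBigO_atTop_of_degree_le (derivative V) V (degree_derivative_le)
  obtain ⟨c, hc0, hc⟩ := hO.exists_pos
  obtain ⟨M, hM⟩ := eventually_atTop.1
    ((hPlim.eventually_le_atBot 0).and (hc.bound.and (eventually_ge_atTop (1 : ℝ))))
  obtain ⟨hM1, hM2, hM3⟩ := hM M le_rfl
  obtain ⟨Q, hQ⟩ := h3
  have hR : P = X ^ 3 * (-2 * Q - X * derivative Q) := by
    rw [hP, hQ]
    simp only [derivative_mul, derivative_X_pow, Nat.cast_ofNat, C_ofNat]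
    ring
  have hS : derivative V = X ^ 2 * (3 * Q + X * derivative Q) := by
    rw [hQ]
    simp only [derivative_mul, derivative_X_pow, Nat.cast_ofNat, C_ofNat]
    ring
  obtain ⟨B₁, hB₁⟩ := (isCompact_Icc (a := (0 : ℝ)) (b := M)).exists_bound_of_continuousOn
    (-2 * Q - X * derivative Q).continuous.continuousOn
  obtain ⟨B₂, hB₂⟩ := (isCompact_Icc (a := (0 : ℝ)) (b := M)).exists_bound_of_continuousOn
    (3 * Q + X * derivative Q).continuous.continuousOn
  have hB₁0 : 0 ≤ B₁ := (norm_nonneg _).trans (hB₁ 0 ⟨le_rfl, by linarith⟩)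
  have hB₂0 : 0 ≤ B₂ := (norm_nonneg _).trans (hB₂ 0 ⟨le_rfl, by linarith⟩)
  refine ⟨B₁ * M + B₂ + c, by positivity, fun s hs => ?_⟩
  have hPs : P.eval s = V.eval s - s * (derivative V).eval s := by simp [hP]
  have hVs := hV s
  have hmin : 0 ≤ s ^ 2 * min s 1 := mul_nonneg (sq_nonneg s) (le_min hs zero_le_one)
  rcases le_total s M with hsM | hsM
  · have h1 := hB₁ s ⟨hs, hsM⟩
    have h2 := hB₂ s ⟨hs, hsM⟩
    rw [Real.norm_eq_abs] at h1 h2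
    constructor
    · have hs3 : s ^ 3 ≤ M * (s ^ 2 * min s 1) := by
        rcases le_total s 1 with h | h
        · rw [min_eq_left h]
          nlinarith [pow_nonneg hs 3]
        · rw [min_eq_right h]
          nlinarith [sq_nonneg s]
      have : P.eval s ≤ B₁ * s ^ 3 := by
        rw [hR, eval_mul, eval_pow, eval_X, mul_comm]
        gcongr
        exact (abs_le.1 h1).2
      have h4 : B₁ * s ^ 3 ≤ B₁ * M * (s ^ 2 * min s 1) := by
        rw [mul_assoc]; gcongr
      have h5 : 0 ≤ (B₂ + c) * (s ^ 2 * min s 1) := by positivity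
      linarith
    · have : |(derivative V).eval s| ≤ B₂ * s ^ 2 := by
        rw [hS, eval_mul, eval_pow, eval_X, abs_mul, abs_of_nonneg (sq_nonneg s), mul_comm]
        gcongr
      have h5 : 0 ≤ (B₁ * M + c) * s ^ 2 := by positivity
      have h6 : 0 ≤ (B₁ * M + B₂ + c) * V.eval s := by positivity
      linarith
  · obtain ⟨k1, k2, k3⟩ := hM s hsM
    constructor
    · have h5 : 0 ≤ (B₁ * M + B₂ + c) * (s ^ 2 * min s 1) := by positivity
      linarith
    · rw [Real.norm_eq_abs, Real.norm_eq_abs, abs_of_nonneg hVs] at k2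
      have h5 : 0 ≤ (B₁ * M + B₂) * V.eval s := by positivity
      have h6 : 0 ≤ (B₁ * M + B₂ + c) * s ^ 2 := by positivity
      linarith

lemma exists_abs_bounds_of_nonneg {V : Polynomial ℝ} (hV : ∀ s : ℝ, 0 ≤ V.eval s)
    (h3 : X ^ 3 ∣ V) : ∃ K : ℝ, 0 ≤ K ∧ ∀ s : ℝ,
      V.eval s ≤ s * (derivative V).eval s + K * (s ^ 2 * min |s| 1) ∧
      |(derivative V).eval s| ≤ K * (s ^ 2 + V.eval s) := by
  obtain ⟨K, hK, h⟩ := exists_bounds_of_nonneg hV h3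
  obtain ⟨L, hL, h'⟩ := exists_bounds_of_nonneg (V := V.comp (-X))
    (fun s => by simpa using hV (-s)) (by
      obtain ⟨Q, rfl⟩ := h3
      exact ⟨-Q.comp (-X), by simp; ring⟩)
  refine ⟨K + L, by positivity, fun s => ?_⟩
  have hVs := hV s
  have hmin : 0 ≤ s ^ 2 * min |s| 1 :=
    mul_nonneg (sq_nonneg s) (le_min (abs_nonneg s) zero_le_one)
  have e1 := mul_nonneg hK hmin
  have e2 := mul_nonneg hL hmin
  have e3 : 0 ≤ K * (s ^ 2 + V.eval s) := by positivity
  have e4 : 0 ≤ L * (s ^ 2 + V.eval s) := by positivity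
  rcases le_total 0 s with hs | hs
  · obtain ⟨a, b⟩ := h s hs
    rw [abs_of_nonneg hs] at *
    constructor <;> linarith
  · obtain ⟨a, b⟩ := h' (-s) (by linarith)
    simp only [derivative_comp, eval_comp, eval_neg, eval_X, neg_neg, derivative_neg,
      derivative_X, abs_neg, neg_sq, neg_mul, mul_neg, one_mul] at a b
    rw [abs_of_nonpos hs] at *
    constructor <;> linarith

/-- The virial inequality for `V'(s) (s - ψ)` when `ψ` is small. -/
lemma exists_virial_bound {V : Polynomial ℝ} (hV : ∀ s : ℝ, 0 ≤ V.eval s) (h3 : X ^ 3 ∣ V) :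
    ∃ K : ℝ, 0 ≤ K ∧ ∀ δ s ψ : ℝ, 0 < δ → |ψ| ≤ δ →
      V.eval s ≤ (s - ψ) * (derivative V).eval s + K * δ * (s ^ 2 + V.eval s)
        + K / δ * (s - ψ) ^ 2 := by
  obtain ⟨K, hK, h⟩ := exists_abs_bounds_of_nonneg hV h3
  refine ⟨3 * K, by positivity, fun δ s ψ hδ hψ => ?_⟩
  obtain ⟨h1, h2⟩ := h s
  have hVs := hV s
  have a1 : |s| ≤ |s - ψ| + δ := by
    have := abs_add_le (s - ψ) ψ
    rw [sub_add_cancel] at this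
    linarith
  have a2 : s ^ 2 * min |s| 1 ≤ δ * s ^ 2 + |s| * |s - ψ| := by
    have hs := abs_nonneg s
    have hd := abs_nonneg (s - ψ)
    rw [← sq_abs s]
    have hsd := mul_nonneg hs hd
    rcases le_total |s| 1 with h | h
    · rw [min_eq_left h]
      nlinarith [mul_le_mul_of_nonneg_left a1 (sq_nonneg |s|), mul_nonneg hsd (sub_nonneg.2 h)]
    · rw [min_eq_right h]
      nlinarith [mul_nonneg hδ.le (mul_nonneg hs (sub_nonneg.2 h)),
        mul_le_mul_of_nonneg_left a1 hs]
  have a3 : |s| * |s - ψ| ≤ δ * s ^ 2 + 1 / δ * (s - ψ) ^ 2 := by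
    rw [← sq_abs s, ← sq_abs (s - ψ)]
    have : δ * |s| ^ 2 + 1 / δ * |s - ψ| ^ 2 - |s| * |s - ψ|
        = (δ * |s| - |s - ψ| / 2) ^ 2 / δ + 3 / 4 * |s - ψ| ^ 2 / δ := by
      field_simp
      ring
    have : 0 ≤ (δ * |s| - |s - ψ| / 2) ^ 2 / δ + 3 / 4 * |s - ψ| ^ 2 / δ := by positivity
    linarith
  have a4 : ψ * (derivative V).eval s ≤ δ * (K * (s ^ 2 + V.eval s)) := by
    refine (le_abs_self _).trans ?_
    rw [abs_mul]
    gcongr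
  have a5 := mul_le_mul_of_nonneg_left (a2.trans (add_le_add_right a3 _)) hK
  have a6 : 0 ≤ K * δ * V.eval s := by positivity
  have a7 : 0 ≤ K / δ * (s - ψ) ^ 2 := by positivity
  have a8 : K * (1 / δ * (s - ψ) ^ 2) = K / δ * (s - ψ) ^ 2 := by ring
  have a9 : 3 * K / δ * (s - ψ) ^ 2 = 3 * (K / δ * (s - ψ) ^ 2) := by ring
  rw [a9]
  nlinarith

end PolynomialBounds

/-- If `I n + (P n)' ≤ ε` with `|P n| ≤ ε` in the future of `T`, and `I n` is monotone in `n`,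
then all `I n` are simultaneously small at some later time. -/
lemma exists_forall_le_of_add_deriv_le {I P P' : ℕ → ℝ → ℝ} {T ε : ℝ}
    (hI : ∀ n, Continuous (I n)) (hmono : ∀ t, Monotone fun n => I n t)
    (hP : ∀ n t, HasDerivAt (P n) (P' n t) t)
    (h1 : ∀ n, ∀ t ≥ T, I n t + P' n t ≤ ε) (h2 : ∀ n, ∀ t ≥ T, |P n t| ≤ ε) :
    ∃ t ≥ T, ∀ n, I n t ≤ 3 * ε := by
  have hne : ∀ n, (Set.Icc T (T + 1) ∩ {t | I n t ≤ 3 * ε}).Nonempty := by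
    intro n
    obtain ⟨t, ht, hd⟩ := exists_hasDerivAt_eq_slope (P n) (P' n) (lt_add_one T)
      (fun t _ => (hP n t).continuousAt.continuousWithinAt) fun t _ => hP n t
    refine ⟨t, ⟨ht.1.le, ht.2.le⟩, ?_⟩
    have a1 := abs_le.1 (h2 n T le_rfl)
    have a2 := abs_le.1 (h2 n (T + 1) (by linarith))
    have a3 := h1 n t ht.1.le
    rw [add_sub_cancel_left, div_one] at hd
    simp only [Set.mem_ofPred_eq]
    linarith [a1.1, a1.2, a2.1, a2.2]
  have hcl : ∀ n, IsClosed {t | I n t ≤ 3 * ε} := fun n => isClosed_le (hI n) continuous_const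
  obtain ⟨t, ht⟩ := IsCompact.nonempty_iInter_of_sequence_nonempty_isCompact_isClosed
    (fun n => Set.Icc T (T + 1) ∩ {t | I n t ≤ 3 * ε})
    (fun n t ht => ⟨ht.1, (hmono t n.le_succ).trans ht.2⟩) hne
    (isCompact_Icc.inter_right (hcl 0)) fun n => isClosed_Icc.inter (hcl n)
  rw [Set.mem_iInter] at ht
  exact ⟨t, (ht 0).1.1, fun n => (ht n).2⟩

section Virial

variable {m : ℝ} {V : Polynomial ℝ} {Φ Ψ : ℝ × E3 → ℝ}

/-- The spatial part of the energy of the difference, together with the potential energy. -/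
def spaceEn (V : Polynomial ℝ) (Φ Ψ : ℝ × E3 → ℝ) (p : ℝ × E3) : ℝ :=
  ∑ j, pd (ej j) (fun q => Φ q - Ψ q) p ^ 2 + V.eval (Φ p)

/-- The localized virial density. -/
def virial (R : ℝ) (Φ Ψ : ℝ × E3 → ℝ) (p : ℝ × E3) : ℝ :=
  cut 0 R p * ((Φ p - Ψ p) * pd e0 (fun q => Φ q - Ψ q) p)

/-- The localized virial flux. -/
def virialFlux (R : ℝ) (Φ Ψ : ℝ × E3 → ℝ) (j : Fin 3) (p : ℝ × E3) : ℝ :=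
  cut 0 R p * ((Φ p - Ψ p) * pd (ej j) (fun q => Φ q - Ψ q) p)

lemma SmoothSol.virial_identity (h : SmoothSol m V Φ) (h' : SmoothSol m 0 Ψ) (R : ℝ)
    (p : ℝ × E3) :
    pd e0 (virial R Φ Ψ) p - ∑ j, pd (ej j) (virialFlux R Φ Ψ j) p =
      cut 0 R p * (pd e0 (fun q => Φ q - Ψ q) p ^ 2 - ∑ j, pd (ej j) (fun q => Φ q - Ψ q) p ^ 2
        - m ^ 2 * (Φ p - Ψ p) ^ 2 - (Φ p - Ψ p) * (derivative V).eval (Φ p))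
      + cutSlope 0 R p * ((Φ p - Ψ p) *
        ∑ j, p.2 j / jb p.2 * pd (ej j) (fun q => Φ q - Ψ q) p) := by
  have hs : Smooth fun q => Φ q - Ψ q := h.1.sub h'.1
  have hc := smooth_cut 0 R
  have h2 : ∀ v, pd v (pd v fun q => Φ q - Ψ q) p = pd v (pd v Φ) p - pd v (pd v Ψ) p := by
    intro v
    rw [show pd v (fun q => Φ q - Ψ q) = fun q => pd v Φ q - pd v Ψ q from
      funext (pd_sub h.1 h'.1)]
    exact pd_sub h.1.dir h'.1.dir p
  have e := h.2 p
  have e' := h'.2 p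
  simp only [derivative_zero, eval_zero, add_zero] at e'
  have hbox : pd e0 (pd e0 fun q => Φ q - Ψ q) p - ∑ j, pd (ej j) (pd (ej j) fun q => Φ q - Ψ q) p
      = -m ^ 2 * (Φ p - Ψ p) - (derivative V).eval (Φ p) := by
    simp only [h2, Finset.sum_sub_distrib]
    linarith
  unfold virial virialFlux
  rw [pd_mul hc (hs.mul hs.dir), pd_mul hs hs.dir, pd_e0_cut]
  simp only [pd_mul hc (hs.mul hs.dir), pd_mul hs hs.dir, pd_ej_cut]
  generalize hχ : (fun q => Φ q - Ψ q) = χ at *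
  simp only [Fin.sum_univ_three] at *
  linear_combination cut 0 R p * (Φ p - Ψ p) * hbox

lemma sum_pd_sub_sq_le (hs : Smooth Φ) (hs' : Smooth Ψ) (hV : ∀ s : ℝ, 0 ≤ V.eval s)
    (p : ℝ × E3) :
    ∑ j, pd (ej j) (fun q => Φ q - Ψ q) p ^ 2 ≤ 4 * (en m V Φ p + en m 0 Ψ p) := by
  have h1 : ∑ j, pd (ej j) (fun q => Φ q - Ψ q) p ^ 2 ≤
      ∑ j, (2 * pd (ej j) Φ p ^ 2 + 2 * pd (ej j) Ψ p ^ 2) := by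
    refine Finset.sum_le_sum fun j _ => ?_
    rw [pd_sub hs hs']
    nlinarith [sq_nonneg (pd (ej j) Φ p + pd (ej j) Ψ p)]
  rw [Finset.sum_add_distrib, ← Finset.mul_sum, ← Finset.mul_sum] at h1
  have := hV (Φ p)
  simp only [en, eval_zero]
  nlinarith [sq_nonneg (pd e0 Φ p), sq_nonneg (pd e0 Ψ p), sq_nonneg (m * Φ p),
    sq_nonneg (m * Ψ p)]

lemma SmoothSol.exists_virial_le (hm : 0 < m) (h : SmoothSol m V Φ) (h' : SmoothSol m 0 Ψ)
    (hV : ∀ s : ℝ, 0 ≤ V.eval s) (h3 : X ^ 3 ∣ V) : ∃ C : ℝ, 0 ≤ C ∧ ∀ δ R p, 0 < δ →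
      |Ψ p| ≤ δ → cut 0 R p * spaceEn V Φ Ψ p
        + (pd e0 (virial R Φ Ψ) p - ∑ j, pd (ej j) (virialFlux R Φ Ψ j) p) ≤
      pd e0 (fun q => Φ q - Ψ q) p ^ 2 + C * δ * (en m V Φ p + en m 0 Ψ p)
        + C / δ * (Φ p - Ψ p) ^ 2 := by
  obtain ⟨K, hK, hvir⟩ := exists_virial_bound hV h3
  obtain ⟨c, hc0, hc⟩ := exists_deriv_smoothTransition_le
  refine ⟨K * (2 / m ^ 2 + 1) + 4 + K + c ^ 2, by positivity, fun δ R p hδ hψ => ?_⟩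
  rw [h.virial_identity h', spaceEn]
  have b1 := hvir δ (Φ p) (Ψ p) hδ hψ
  have b2 := sum_pd_sub_sq_le (m := m) h.1 h'.1 hV p
  have b3 := Finset.sum_mul_sq_le_sq_mul_sq Finset.univ (fun j => p.2 j / jb p.2)
    (fun j => pd (ej j) (fun q => Φ q - Ψ q) p)
  have b4 := sum_div_jb_sq_le p.2
  have hS0 : 0 ≤ ∑ j, pd (ej j) (fun q => Φ q - Ψ q) p ^ 2 :=
    Finset.sum_nonneg fun j _ => sq_nonneg _
  have b5 := b3.trans (mul_le_of_le_one_left hS0 b4)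
  have hk0 : 0 ≤ cutSlope 0 R p := deriv_smoothTransition_nonneg _
  have hk : cutSlope 0 R p ≤ c := hc _
  have hz0 := cut_nonneg 0 R p
  have hz1 := cut_le_one 0 R p
  have hE := en_nonneg (m := m) hV Φ p
  have hE' := en_nonneg (m := m) (V := 0) (by simp) Ψ p
  have b6 : Φ p ^ 2 + V.eval (Φ p) ≤ (2 / m ^ 2 + 1) * en m V Φ p := by
    have hΦ : (1 / 2) * m ^ 2 * Φ p ^ 2 + V.eval (Φ p) ≤ en m V Φ p := by
      have : 0 ≤ ∑ j, pd (ej j) Φ p ^ 2 := Finset.sum_nonneg fun j _ => sq_nonneg _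
      unfold en
      nlinarith [sq_nonneg (pd e0 Φ p)]
    have hVp := hV (Φ p)
    have hm2 : 0 ≤ (1 / 2) * m ^ 2 * Φ p ^ 2 := by positivity
    have : Φ p ^ 2 = 2 / m ^ 2 * ((1 / 2) * m ^ 2 * Φ p ^ 2) := by field_simp
    have h2 : 2 / m ^ 2 * ((1 / 2) * m ^ 2 * Φ p ^ 2) ≤ 2 / m ^ 2 * en m V Φ p := by
      gcongr
      linarith
    linarith
  generalize hY : ∑ j, p.2 j / jb p.2 * pd (ej j) (fun q => Φ q - Ψ q) p = Y at *
  generalize ∑ j, pd (ej j) (fun q => Φ q - Ψ q) p ^ 2 = S at *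
  generalize pd e0 (fun q => Φ q - Ψ q) p = a at *
  generalize cutSlope 0 R p = k at *
  generalize en m V Φ p = E at *
  generalize en m 0 Ψ p = E' at *
  generalize cut 0 R p = z at *
  generalize hx : Φ p - Ψ p = x at *
  have b7 : k * (x * Y) ≤ δ * S + c ^ 2 / δ * x ^ 2 := by
    have i1 : k * (x * Y) ≤ δ * Y ^ 2 + k ^ 2 / δ * x ^ 2 := by
      have : δ * Y ^ 2 + k ^ 2 / δ * x ^ 2 - k * (x * Y)
          = ((δ * Y - k * x / 2) ^ 2 + 3 / 4 * (k * x) ^ 2) / δ := by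
        field_simp
        ring
      have : 0 ≤ ((δ * Y - k * x / 2) ^ 2 + 3 / 4 * (k * x) ^ 2) / δ := by positivity
      linarith
    have i2 : δ * Y ^ 2 ≤ δ * S := by gcongr
    have i3 : k ^ 2 / δ * x ^ 2 ≤ c ^ 2 / δ * x ^ 2 := by gcongr
    linarith
  have b8 : K * δ * (Φ p ^ 2 + V.eval (Φ p)) ≤ K * δ * ((2 / m ^ 2 + 1) * E) := by gcongr
  have b9 : δ * S ≤ δ * (4 * (E + E')) := by gcongr
  have b10 : z * (a ^ 2 + V.eval (Φ p) - x * (derivative V).eval (Φ p) - m ^ 2 * x ^ 2) ≤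
      a ^ 2 + K * δ * (Φ p ^ 2 + V.eval (Φ p)) + K / δ * x ^ 2 := by
    have hVp := hV (Φ p)
    have n : 0 ≤ a ^ 2 + K * δ * (Φ p ^ 2 + V.eval (Φ p)) + K / δ * x ^ 2 := by positivity
    refine le_trans (mul_le_mul_of_nonneg_left ?_ hz0) (mul_le_of_le_one_left n hz1)
    have : 0 ≤ m ^ 2 * x ^ 2 := by positivity
    linarith
  have n1 : 0 ≤ (K + c ^ 2) * δ * (E + E') := by positivity
  have n2 : 0 ≤ K * (2 / m ^ 2 + 1) * δ * E' := by positivity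
  have n3 : 0 ≤ (K * (2 / m ^ 2 + 1) + 4) / δ * x ^ 2 := by positivity
  have n4 : (K * (2 / m ^ 2 + 1) + 4 + K + c ^ 2) / δ * x ^ 2 =
    (K * (2 / m ^ 2 + 1) + 4) / δ * x ^ 2 + K / δ * x ^ 2 + c ^ 2 / δ * x ^ 2 := by ring
  rw [n4]
  linarith

lemma SchwartzData.memLp_sub (h : SchwartzData Φ) (h' : SchwartzData Ψ) (t : ℝ) :
    L2At t fun q => Φ q - Ψ q := (h.memLp t).sub (h'.memLp t)

lemma SchwartzData.memLp_e0_sub (h : SchwartzData Φ) (h' : SchwartzData Ψ) (hs : Smooth Φ)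
    (hs' : Smooth Ψ) (t : ℝ) : L2At t (pd e0 fun q => Φ q - Ψ q) :=
  ((h.memLp_e0 t).sub (h'.memLp_e0 t)).ae_eq (.of_forall fun x => (pd_sub hs hs' (t, x)).symm)

lemma SchwartzData.memLp_ej_sub (h : SchwartzData Φ) (h' : SchwartzData Ψ) (hs : Smooth Φ)
    (hs' : Smooth Ψ) (t : ℝ) (j : Fin 3) : L2At t (pd (ej j) fun q => Φ q - Ψ q) :=
  ((h.memLp_ej hs t j).sub (h'.memLp_ej hs' t j)).ae_eq
    (.of_forall fun x => (pd_sub hs hs' (t, x)).symm)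

lemma SchwartzData.integrable_spaceEn (h : SchwartzData Φ) (h' : SchwartzData Ψ) (hs : Smooth Φ)
    (hs' : Smooth Ψ) (hV : X ^ 2 ∣ V) (t : ℝ) : Integrable fun x => spaceEn V Φ Ψ (t, x) :=
  (integrable_finsetSum _ fun j _ => (h.memLp_ej_sub h' hs hs' t j).integrable_sq).add
    (h.integrable_eval t hV)

lemma smooth_virial (hs : Smooth Φ) (hs' : Smooth Ψ) (R : ℝ) : Smooth (virial R Φ Ψ) :=
  (smooth_cut 0 R).mul ((hs.sub hs').mul (Smooth.dir (hs.sub hs')))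

lemma smooth_virialFlux (hs : Smooth Φ) (hs' : Smooth Ψ) (R : ℝ) (j : Fin 3) :
    Smooth (virialFlux R Φ Ψ j) :=
  (smooth_cut 0 R).mul ((hs.sub hs').mul (Smooth.dir (hs.sub hs')))

lemma smooth_spaceEn (hs : Smooth Φ) (hs' : Smooth Ψ) (V : Polynomial ℝ) :
    Smooth (spaceEn V Φ Ψ) :=
  (ContDiff.sum fun _ _ => (Smooth.dir (hs.sub hs')).pow 2).add (hs.eval V)

lemma spaceSupp_virial (R : ℝ) (Φ Ψ : ℝ × E3 → ℝ) : SpaceSupp (virial R Φ Ψ) :=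
  (spaceSupp_cut 0 R).mul_right _

lemma spaceSupp_virialFlux (R : ℝ) (Φ Ψ : ℝ × E3 → ℝ) (j : Fin 3) :
    SpaceSupp (virialFlux R Φ Ψ j) :=
  (spaceSupp_cut 0 R).mul_right _

lemma spaceEn_nonneg (hV : ∀ s : ℝ, 0 ≤ V.eval s) (p : ℝ × E3) : 0 ≤ spaceEn V Φ Ψ p :=
  add_nonneg (Finset.sum_nonneg fun _ _ => sq_nonneg _) (hV _)

lemma cut_mono_radius (a : ℝ) (p : ℝ × E3) : Monotone fun R => cut a R p := fun R R' h =>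
  Real.smoothTransition.monotone (by linarith)

lemma SchwartzData.abs_integral_virial_le (h : SchwartzData Φ) (h' : SchwartzData Ψ)
    (hs : Smooth Φ) (hs' : Smooth Ψ) (R t : ℝ) :
    |∫ x, virial R Φ Ψ (t, x)| ≤ (∫ x, (Φ (t, x) - Ψ (t, x)) ^ 2)
      + ∫ x, pd e0 (fun q => Φ q - Ψ q) (t, x) ^ 2 := by
  have i1 := (h.memLp_sub h' t).integrable_sq
  have i2 := (h.memLp_e0_sub h' hs hs' t).integrable_sq
  have e := integral_add i1 i2
  simp only at e
  rw [← e, ← Real.norm_eq_abs]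
  refine norm_integral_le_of_norm_le (i1.add i2) (.of_forall fun x => ?_)
  rw [virial, norm_mul, Real.norm_of_nonneg (cut_nonneg _ _ _)]
  refine (mul_le_of_le_one_left (norm_nonneg _) (cut_le_one _ _ _)).trans ?_
  rw [Real.norm_eq_abs, abs_le]
  set a := Φ (t, x) - Ψ (t, x)
  set b := pd e0 (fun q => Φ q - Ψ q) (t, x)
  constructor <;> nlinarith [sq_nonneg (a + b), sq_nonneg (a - b)]

lemma SmoothSol.integral_cut_mul_spaceEn_add_le (h : SmoothSol m V Φ) (h' : SmoothSol m 0 Ψ)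
    (hd : SchwartzData Φ) (hd' : SchwartzData Ψ) (hV2 : X ^ 2 ∣ V) {A B R t : ℝ}
    (hp : ∀ x, cut 0 R (t, x) * spaceEn V Φ Ψ (t, x) + (pd e0 (virial R Φ Ψ) (t, x)
        - ∑ j, pd (ej j) (virialFlux R Φ Ψ j) (t, x)) ≤
      pd e0 (fun q => Φ q - Ψ q) (t, x) ^ 2 + A * (en m V Φ (t, x) + en m 0 Ψ (t, x))
        + B * (Φ (t, x) - Ψ (t, x)) ^ 2) :
    (∫ x, cut 0 R (t, x) * spaceEn V Φ Ψ (t, x)) + ∫ x, pd e0 (virial R Φ Ψ) (t, x) ≤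
      (∫ x, pd e0 (fun q => Φ q - Ψ q) (t, x) ^ 2)
        + A * ((∫ x, en m V Φ (t, x)) + ∫ x, en m 0 Ψ (t, x))
        + B * ∫ x, (Φ (t, x) - Ψ (t, x)) ^ 2 := by
  have j1 := (hd.memLp_e0_sub hd' h.1 h'.1 t).integrable_sq
  have j2 := hd.integrable_en (m := m) h.1 hV2 t
  have j3 := hd'.integrable_en (m := m) h'.1 (dvd_zero _) t
  have j4 := (hd.memLp_sub hd' t).integrable_sq
  have i1 : Integrable fun x => cut 0 R (t, x) * spaceEn V Φ Ψ (t, x) :=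
    ((spaceSupp_cut 0 R).mul_right _).integrable
      ((smooth_cut 0 R).continuous.mul (smooth_spaceEn h.1 h'.1 V).continuous) t
  have i2 : Integrable fun x => pd e0 (virial R Φ Ψ) (t, x) :=
    ((spaceSupp_virial R Φ Ψ).dir _).integrable (smooth_virial h.1 h'.1 R).dir.continuous t
  have i3 : ∀ j ∈ (Finset.univ : Finset (Fin 3)), Integrable fun x =>
      pd (ej j) (virialFlux R Φ Ψ j) (t, x) := fun j _ =>
    ((spaceSupp_virialFlux R Φ Ψ j).dir _).integrable
      (smooth_virialFlux h.1 h'.1 R j).dir.continuous t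
  have hflux : ∫ x, ∑ j, pd (ej j) (virialFlux R Φ Ψ j) (t, x) = 0 := by
    rw [integral_finsetSum _ i3]
    exact Finset.sum_eq_zero fun j _ =>
      (spaceSupp_virialFlux R Φ Ψ j).integral_dir_space (smooth_virialFlux h.1 h'.1 R j) t j
  have i4 := integrable_finsetSum _ i3
  have key := integral_mono (i1.add (i2.sub i4))
    ((j1.add ((j2.add j3).const_mul A)).add (j4.const_mul B)) hp
  have e1 := integral_add i1 (i2.sub i4)
  have e2 := integral_sub i2 i4
  have e3 := integral_add (j1.add ((j2.add j3).const_mul A)) (j4.const_mul B)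
  have e4 := integral_add j1 ((j2.add j3).const_mul A)
  have e5 := integral_add j2 j3
  have e6 := integral_const_mul (μ := volume) A fun x => en m V Φ (t, x) + en m 0 Ψ (t, x)
  have e7 := integral_const_mul (μ := volume) B fun x => (Φ (t, x) - Ψ (t, x)) ^ 2
  simp only [Pi.add_apply, Pi.sub_apply] at key e1 e2 e3 e4 e5 e6 e7
  rw [e1, e2, e3, e4, e6, e7, e5, hflux, sub_zero] at key
  exact key

/-- Along a suitable sequence of times the spatial energy of the difference tends to zero. -/
lemma SmoothSol.exists_integral_spaceEn_le (hm : 0 < m) (h : SmoothSol m V Φ)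
    (h' : SmoothSol m 0 Ψ) (hd : SchwartzData Φ) (hd' : SchwartzData Ψ)
    (hV : ∀ s : ℝ, 0 ≤ V.eval s) (h3 : X ^ 3 ∣ V)
    (l0 : Tendsto (fun t => ∫ x, (Φ (t, x) - Ψ (t, x)) ^ 2) atTop (𝓝 0))
    (l1 : Tendsto (fun t => ∫ x, pd e0 (fun q => Φ q - Ψ q) (t, x) ^ 2) atTop (𝓝 0))
    {ε : ℝ} (hε : 0 < ε) (T₀ : ℝ) : ∃ t ≥ T₀, ∫ x, spaceEn V Φ Ψ (t, x) ≤ 3 * ε := by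
  have hV2 : X ^ 2 ∣ V := (pow_dvd_pow X (by norm_num)).trans h3
  obtain ⟨C, hC, hvir⟩ := h.exists_virial_le hm h' hV h3
  set E := (∫ x, en m V Φ (0, x)) + ∫ x, en m 0 Ψ (0, x) with hE
  have hE0 : 0 ≤ E := add_nonneg (integral_nonneg fun x => en_nonneg hV Φ _)
    (integral_nonneg fun x => en_nonneg (by simp) Ψ _)
  have hEt : ∀ t, (∫ x, en m V Φ (t, x)) + ∫ x, en m 0 Ψ (t, x) = E := fun t => by
    rw [hE, h.integral_en_eq hd hV hV2 t 0,
      h'.integral_en_eq hd' (by simp) (dvd_zero _) t 0]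
  obtain ⟨δ, hδ, hδE⟩ : ∃ δ : ℝ, 0 < δ ∧ C * δ * E ≤ ε / 2 := by
    refine ⟨ε / (2 * (C * E + 1)), by positivity, ?_⟩
    have : 0 ≤ C * E := by positivity
    rw [show C * (ε / (2 * (C * E + 1))) * E = ε / 2 * (C * E / (C * E + 1)) by field_simp]
    exact mul_le_of_le_one_right (by positivity) ((div_le_one (by positivity)).2 (by linarith))
  have lim : Tendsto (fun t => (∫ x, pd e0 (fun q => Φ q - Ψ q) (t, x) ^ 2)
      + C / δ * ∫ x, (Φ (t, x) - Ψ (t, x)) ^ 2) atTop (𝓝 0) := by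
    simpa using l1.add (l0.const_mul (C / δ))
  have lim' : Tendsto (fun t => (∫ x, (Φ (t, x) - Ψ (t, x)) ^ 2)
      + ∫ x, pd e0 (fun q => Φ q - Ψ q) (t, x) ^ 2) atTop (𝓝 0) := by
    simpa using l0.add l1
  obtain ⟨T, hT⟩ := eventually_atTop.1 ((h'.free_decay hm hd' hδ).and
    ((lim.eventually_le_const (half_pos hε)).and
      ((lim'.eventually_le_const hε).and (eventually_ge_atTop T₀))))
  have hcs : ∀ n : ℕ, SpaceSupp fun p => cut 0 n p * spaceEn V Φ Ψ p := fun n =>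
    (spaceSupp_cut 0 n).mul_right _
  have hcm : ∀ n : ℕ, Smooth fun p => cut 0 n p * spaceEn V Φ Ψ p := fun n =>
    (smooth_cut 0 n).mul (smooth_spaceEn h.1 h'.1 V)
  obtain ⟨t, ht, hn⟩ := exists_forall_le_of_add_deriv_le (T := T) (ε := ε)
    (I := fun n t => ∫ x, cut 0 n (t, x) * spaceEn V Φ Ψ (t, x))
    (P := fun n t => ∫ x, virial n Φ Ψ (t, x))
    (P' := fun n t => ∫ x, pd e0 (virial n Φ Ψ) (t, x))
    (fun n => continuous_iff_continuousAt.2 fun t =>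
      ((hcs n).hasDerivAt_integral (hcm n) t).continuousAt)
    (fun t n k hnk => integral_mono ((hcs n).integrable (hcm n).continuous t)
      ((hcs k).integrable (hcm k).continuous t) fun x =>
        mul_le_mul_of_nonneg_right (cut_mono_radius 0 (t, x) (Nat.cast_le.2 hnk))
          (spaceEn_nonneg hV _))
    (fun n t => (spaceSupp_virial n Φ Ψ).hasDerivAt_integral (smooth_virial h.1 h'.1 n) t)
    (fun n t ht => by
      obtain ⟨k1, k2, -⟩ := hT t ht
      have := h.integral_cut_mul_spaceEn_add_le h' hd hd' hV2
        fun x => hvir δ n (t, x) hδ (k1 x)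
      rw [hEt] at this
      linarith)
    (fun n t ht => (hd.abs_integral_virial_le hd' h.1 h'.1 n t).trans (hT t ht).2.2.1)
  refine ⟨t, (hT t ht).2.2.2, ?_⟩
  have hi := hd.integrable_spaceEn hd' h.1 h'.1 hV2 t
  refine le_of_tendsto (tendsto_integral_of_dominated_convergence _
    (fun n => ((hcs n).integrable (hcm n).continuous t).aestronglyMeasurable) hi
    (fun n => .of_forall fun x => ?_) (.of_forall fun x => ?_)) (.of_forall hn)
  · rw [Real.norm_of_nonneg (mul_nonneg (cut_nonneg _ _ _) (spaceEn_nonneg hV _))]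
    exact mul_le_of_le_one_left (spaceEn_nonneg hV _) (cut_le_one _ _ _)
  · simpa using (tendsto_cut 0 (t, x)).mul_const (spaceEn V Φ Ψ (t, x))

lemma abs_en_sub_en_le (hs : Smooth Φ) (hs' : Smooth Ψ) (hV : ∀ s : ℝ, 0 ≤ V.eval s)
    {r : ℝ} (hr : 0 < r) (p : ℝ × E3) :
    |en m V Φ p - en m 0 Ψ p| ≤ 2 * r * (en m V Φ p + en m 0 Ψ p)
      + (1 / r + 1) * (pd e0 (fun q => Φ q - Ψ q) p ^ 2 + m ^ 2 * (Φ p - Ψ p) ^ 2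
        + spaceEn V Φ Ψ p) := by
  have key : ∀ a b : ℝ, |a ^ 2 - b ^ 2| ≤ 2 * r * (a ^ 2 + b ^ 2) + 1 / r * (a - b) ^ 2 := by
    intro a b
    have e1 : 2 * r * (a ^ 2 + b ^ 2) + 1 / r * (a - b) ^ 2 - (a ^ 2 - b ^ 2) =
      ((r * (a + b) - (a - b) / 2) ^ 2 + 3 / 4 * (a - b) ^ 2 + (r * (a - b)) ^ 2) / r := by
      field_simp
      ring
    have e2 : 2 * r * (a ^ 2 + b ^ 2) + 1 / r * (a - b) ^ 2 + (a ^ 2 - b ^ 2) =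
      ((r * (a + b) + (a - b) / 2) ^ 2 + 3 / 4 * (a - b) ^ 2 + (r * (a - b)) ^ 2) / r := by
      field_simp
      ring
    have n1 : 0 ≤ ((r * (a + b) - (a - b) / 2) ^ 2 + 3 / 4 * (a - b) ^ 2
      + (r * (a - b)) ^ 2) / r := by positivity
    have n2 : 0 ≤ ((r * (a + b) + (a - b) / 2) ^ 2 + 3 / 4 * (a - b) ^ 2
      + (r * (a - b)) ^ 2) / r := by positivity
    exact abs_le.2 ⟨by linarith, by linarith⟩
  have k0 := abs_le.1 (key (pd e0 Φ p) (pd e0 Ψ p))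
  have kj := fun j => abs_le.1 (key (pd (ej j) Φ p) (pd (ej j) Ψ p))
  have kz := abs_le.1 (key (m * Φ p) (m * Ψ p))
  have hVp := hV (Φ p)
  have n0 : 0 ≤ 1 / r * V.eval (Φ p) := by positivity
  have n1 : 0 ≤ r * V.eval (Φ p) := by positivity
  have n2 : 0 ≤ 1 / r * (pd e0 Φ p - pd e0 Ψ p) ^ 2 := by positivity
  have n3 : ∀ j, 0 ≤ 1 / r * (pd (ej j) Φ p - pd (ej j) Ψ p) ^ 2 := fun j => by positivity
  have n4 : 0 ≤ 1 / r * (m * Φ p - m * Ψ p) ^ 2 := by positivity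
  have n5 := sq_nonneg (pd e0 Φ p - pd e0 Ψ p)
  have n6 := fun j => sq_nonneg (pd (ej j) Φ p - pd (ej j) Ψ p)
  have n7 := sq_nonneg (m * Φ p - m * Ψ p)
  simp only [en, spaceEn, pd_sub hs hs', Fin.sum_univ_three, eval_zero]
  rw [show m ^ 2 * (Φ p - Ψ p) ^ 2 = (m * Φ p - m * Ψ p) ^ 2 by ring,
    mul_assoc (1 / 2) (m ^ 2), mul_assoc (1 / 2) (m ^ 2), ← mul_pow, ← mul_pow, abs_le]
  constructor <;> linarith [kj 0, kj 1, kj 2, n3 0, n3 1, n3 2, n6 0, n6 1, n6 2, (kj 0).1,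
    (kj 1).1, (kj 2).1, (kj 0).2, (kj 1).2, (kj 2).2, k0.1, k0.2, kz.1, kz.2]

/-- The interacting energy equals the free energy of an asymptote. -/
lemma SmoothSol.integral_en_eq_of_asymptotic (hm : 0 < m) (h : SmoothSol m V Φ)
    (h' : SmoothSol m 0 Ψ) (hd : SchwartzData Φ) (hd' : SchwartzData Ψ)
    (hV : ∀ s : ℝ, 0 ≤ V.eval s) (h3 : X ^ 3 ∣ V)
    (l0 : Tendsto (fun t => ∫ x, (Φ (t, x) - Ψ (t, x)) ^ 2) atTop (𝓝 0))
    (l1 : Tendsto (fun t => ∫ x, pd e0 (fun q => Φ q - Ψ q) (t, x) ^ 2) atTop (𝓝 0))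
    (s t : ℝ) : ∫ x, en m V Φ (s, x) = ∫ x, en m 0 Ψ (t, x) := by
  have hV2 : X ^ 2 ∣ V := (pow_dvd_pow X (by norm_num)).trans h3
  set E := ∫ x, en m V Φ (s, x) with hE
  set F := ∫ x, en m 0 Ψ (t, x) with hF
  have hE0 : 0 ≤ E := integral_nonneg fun x => en_nonneg hV Φ _
  have hF0 : 0 ≤ F := integral_nonneg fun x => en_nonneg (by simp) Ψ _
  have main : ∀ r : ℝ, 0 < r → |E - F| ≤ 2 * r * (E + F) + r := by
    intro r hr
    have lim : Tendsto (fun t => (∫ x, pd e0 (fun q => Φ q - Ψ q) (t, x) ^ 2)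
        + m ^ 2 * ∫ x, (Φ (t, x) - Ψ (t, x)) ^ 2) atTop (𝓝 0) := by
      simpa using l1.add (l0.const_mul (m ^ 2))
    set ε := r / (4 * (1 / r + 1)) with hεd
    have hε : 0 < ε := by positivity
    obtain ⟨T, hT⟩ := eventually_atTop.1 (lim.eventually_le_const hε)
    obtain ⟨u, hu, hsp⟩ := h.exists_integral_spaceEn_le hm h' hd hd' hV h3 l0 l1 hε T
    have hu' := hT u hu
    have j1 := (hd.memLp_e0_sub hd' h.1 h'.1 u).integrable_sq
    have j2 := hd.integrable_en (m := m) h.1 hV2 u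
    have j3 := hd'.integrable_en (m := m) h'.1 (dvd_zero _) u
    have j4 := (hd.memLp_sub hd' u).integrable_sq
    have j5 := hd.integrable_spaceEn hd' h.1 h'.1 hV2 u
    have hEu : ∫ x, en m V Φ (u, x) = E := h.integral_en_eq hd hV hV2 u s
    have hFu : ∫ x, en m 0 Ψ (u, x) = F := h'.integral_en_eq hd' (by simp) (dvd_zero _) u t
    have i1 := (j2.add j3).const_mul (2 * r)
    have i2 := (j1.add (j4.const_mul (m ^ 2))).add j5
    have e1 := integral_add i1 (i2.const_mul (1 / r + 1))
    have e2 := integral_const_mul (μ := volume) (2 * r)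
      fun x => en m V Φ (u, x) + en m 0 Ψ (u, x)
    have e3 := integral_add j2 j3
    have e4 := integral_const_mul (μ := volume) (1 / r + 1) fun x =>
      pd e0 (fun q => Φ q - Ψ q) (u, x) ^ 2 + m ^ 2 * (Φ (u, x) - Ψ (u, x)) ^ 2
        + spaceEn V Φ Ψ (u, x)
    have e5 := integral_add (j1.add (j4.const_mul (m ^ 2))) j5
    have e6 := integral_add j1 (j4.const_mul (m ^ 2))
    have e7 := integral_const_mul (μ := volume) (m ^ 2) fun x => (Φ (u, x) - Ψ (u, x)) ^ 2
    have key := norm_integral_le_of_norm_le (f := fun x => en m V Φ (u, x) - en m 0 Ψ (u, x))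
      (i1.add (i2.const_mul (1 / r + 1)))
      (.of_forall fun x => abs_en_sub_en_le h.1 h'.1 hV hr (u, x))
    simp only [Pi.add_apply] at key e1 e2 e3 e4 e5 e6 e7
    rw [integral_sub j2 j3, e1, e2, e3, e4, e5, e6, e7, hEu, hFu, Real.norm_eq_abs] at key
    have hfin : (1 / r + 1) * (4 * ε) = r := by
      rw [hεd]
      field_simp
    have := mul_le_mul_of_nonneg_left (add_le_add hu' hsp) (by positivity : 0 ≤ 1 / r + 1)
    linarith
  have lim : Tendsto (fun r : ℝ => 2 * r * (E + F) + r) (𝓝[>] 0) (𝓝 0) := by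
    have : Continuous fun r : ℝ => 2 * r * (E + F) + r := by fun_prop
    simpa using (this.tendsto 0).mono_left nhdsWithin_le_nhds
  have h0 : |E - F| ≤ 0 := ge_of_tendsto lim (by
    filter_upwards [self_mem_nhdsWithin] with r hr using main r hr)
  linarith [abs_nonpos_iff.1 h0]

end Virial

lemma toReal_eLpNorm_sq {f : E3 → ℝ} (hf : MemLp f 2) :
    (eLpNorm f 2 volume).toReal ^ 2 = ∫ x, f x ^ 2 := by
  rw [hf.eLpNorm_eq_integral_rpow_norm two_ne_zero ENNReal.ofNat_ne_top, ENNReal.toReal_ofReal]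
  · simp only [ENNReal.toReal_ofNat, Real.rpow_ofNat, Real.norm_eq_abs, sq_abs]
    rw [← Real.rpow_natCast, ← Real.rpow_mul (integral_nonneg fun x => sq_nonneg _)]
    norm_num
  · positivity

lemma tendsto_integral_sq {l : Filter ℝ} {f : ℝ → E3 → ℝ} (hf : ∀ t, MemLp (f t) 2)
    (h : Tendsto (fun t => eLpNorm (f t) 2 volume) l (𝓝 0)) :
    Tendsto (fun t => ∫ x, f t x ^ 2) l (𝓝 0) := by
  simp only [← toReal_eLpNorm_sq (hf _)]
  simpa using ((ENNReal.tendsto_toReal ENNReal.zero_ne_top).comp h).pow 2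

section Asymptotes

variable {m : ℝ} {V : Polynomial ℝ} {Φ Ψ : ℝ × E3 → ℝ}

lemma PastAsym.rev (hs : Smooth Φ) (hs' : Smooth Ψ) (h : PastAsym Φ Ψ) :
    FutureAsym (rev Φ) (rev Ψ) := by
  refine (h.comp tendsto_neg_atTop_atBot).congr fun t => ?_
  simp only [Function.comp_apply, timeDeriv_eq_pd hs, timeDeriv_eq_pd hs',
    timeDeriv_eq_pd hs.rev, timeDeriv_eq_pd hs'.rev, pd_e0_rev hs, pd_e0_rev hs']
  congr 1
  rw [← eLpNorm_neg]
  congr 1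
  funext x
  simp only [Pi.neg_apply, _root_.rev]
  ring

lemma SmoothSol.integral_en_eq_of_futureAsym (hm : 0 < m) (h : SmoothSol m V Φ)
    (h' : SmoothSol m 0 Ψ) (hd : SchwartzData Φ) (hd' : SchwartzData Ψ)
    (hV : ∀ s : ℝ, 0 ≤ V.eval s) (h3 : X ^ 3 ∣ V) (hf : FutureAsym Φ Ψ) (s t : ℝ) :
    ∫ x, en m V Φ (s, x) = ∫ x, en m 0 Ψ (t, x) := by
  simp only [FutureAsym, timeDeriv_eq_pd h.1, timeDeriv_eq_pd h'.1,
    ← pd_sub h.1 h'.1] at hf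
  refine h.integral_en_eq_of_asymptotic hm h' hd hd' hV h3
    (tendsto_integral_sq (fun t => hd.memLp_sub hd' t) ?_)
    (tendsto_integral_sq (fun t => hd.memLp_e0_sub hd' h.1 h'.1 t) ?_) s t
  · exact tendsto_of_tendsto_of_tendsto_of_le_of_le tendsto_const_nhds hf
      (fun _ => zero_le) fun _ => le_self_add
  · exact tendsto_of_tendsto_of_tendsto_of_le_of_le tendsto_const_nhds hf
      (fun _ => zero_le) fun _ => le_add_self

lemma SmoothSol.integral_en_eq_of_pastAsym (hm : 0 < m) (h : SmoothSol m V Φ)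
    (h' : SmoothSol m 0 Ψ) (hd : SchwartzData Φ) (hd' : SchwartzData Ψ)
    (hV : ∀ s : ℝ, 0 ≤ V.eval s) (h3 : X ^ 3 ∣ V) (hf : PastAsym Φ Ψ) (s t : ℝ) :
    ∫ x, en m V Φ (s, x) = ∫ x, en m 0 Ψ (t, x) := by
  have := h.rev.integral_en_eq_of_futureAsym hm h'.rev (hd.rev h.1) (hd'.rev h'.1) hV h3
    (hf.rev h.1 h'.1) (-s) (-t)
  simpa [en_rev h.1, en_rev h'.1] using this

end Asymptotes

/-- the conserved interacting energy of a global solution equals the free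
energy of its future (resp. past) free asymptote, at all times. -/
theorem stmt_12 (m : ℝ) (hm : 0 < m) (V : Polynomial ℝ)
    (hV0 : V.eval 0 = 0) (hV1 : (derivative V).eval 0 = 0)
    (hV2 : (derivative (derivative V)).eval 0 = 0) (hVpos : ∀ s : ℝ, 0 ≤ V.eval s)
    (Φ : ℝ × E3 → ℝ) (hΦ : IsGlobalSol m V Φ) :
    (∀ Φp : ℝ × E3 → ℝ, IsFreeSol m Φp → FutureAsym Φ Φp →
      ∀ t s : ℝ,
        (∫ x : E3, ((1 / 2) * (timeDeriv Φ t x) ^ 2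
            + (1 / 2) * ‖gradient (fun y => Φ (t, y)) x‖ ^ 2
            + (1 / 2) * m ^ 2 * (Φ (t, x)) ^ 2 + V.eval (Φ (t, x))))
        = ∫ x : E3, ((1 / 2) * (timeDeriv Φp s x) ^ 2
            + (1 / 2) * ‖gradient (fun y => Φp (s, y)) x‖ ^ 2
            + (1 / 2) * m ^ 2 * (Φp (s, x)) ^ 2)) ∧
    (∀ Φm : ℝ × E3 → ℝ, IsFreeSol m Φm → PastAsym Φ Φm →
      ∀ t s : ℝ,
        (∫ x : E3, ((1 / 2) * (timeDeriv Φ t x) ^ 2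
            + (1 / 2) * ‖gradient (fun y => Φ (t, y)) x‖ ^ 2
            + (1 / 2) * m ^ 2 * (Φ (t, x)) ^ 2 + V.eval (Φ (t, x))))
        = ∫ x : E3, ((1 / 2) * (timeDeriv Φm s x) ^ 2
            + (1 / 2) * ‖gradient (fun y => Φm (s, y)) x‖ ^ 2
            + (1 / 2) * m ^ 2 * (Φm (s, x)) ^ 2)) := by
  have h := hΦ.smoothSol
  have h3 := X_pow_three_dvd hV0 hV1 hV2
  refine ⟨fun Ψ hΨ hf t s => ?_, fun Ψ hΨ hf t s => ?_⟩
  · have h' := hΨ.smoothSol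
    have := h.integral_en_eq_of_futureAsym hm h' hΦ.schwartzData hΨ.schwartzData hVpos h3 hf t s
    simpa only [timeDeriv_eq_pd h.1, timeDeriv_eq_pd h'.1, norm_gradient_sq h.1,
      norm_gradient_sq h'.1, en, eval_zero, add_zero] using this
  · have h' := hΨ.smoothSol
    have := h.integral_en_eq_of_pastAsym hm h' hΦ.schwartzData hΨ.schwartzData hVpos h3 hf t s
    simpa only [timeDeriv_eq_pd h.1, timeDeriv_eq_pd h'.1, norm_gradient_sq h.1,
      norm_gradient_sq h'.1, en, eval_zero, add_zero] using this
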